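/- Let σ ∈ S_k be a pattern and suppose μ ∈ ℳ is CNC with respect to σ. There exists θ_c > 0, depending only on k, such that for each θ ∈ (−θ_c,θ_c) the supremum sup_{ν∈ℳ}{θ t_σ(ν) − D(ν|μ)} has a unique maximizer ν_θ; set δ_c := sup_{θ∈(−θ_c,θ_c)} t_σ(ν_θ). Then δ_c > t_σ(μ) and for every δ ∈ (t_σ(μ), δ_c): (a) θ̂(δ) := max{θ > 0 : t_σ(ν_θ) = δ} is a well-defined element of (0,θ_c) and satisfies t_σ(ν_{θ̂(δ)}) = δ; (b) 𝒢(σ,μ,δ) = {ν_{θ̂(δ)}}; (c) G(σ,μ,·) is continuous on (t_σ(μ), δ_c); and (d) conditioned on the event {t_σ(π_{n,μ}) ≥ δ}, the Lévy–Prokhorov distance between Em(π_{n,μ}) and 𝒪(ν_{θ̂(δ)}) converges to 0 in probability, i.e. for every ε > 0, P({d_LP(Em(π_{n,μ}), 𝒪(ν_{θ̂(δ)})) ≥ ε} ∩ {t_σ(π_{n,μ}) ≥ δ}) / P(t_σ(π_{n,μ}) ≥ δ) → 0 as n → ∞. -/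

import Mathlib

open MeasureTheory Filter Topology
open scoped ENNReal

noncomputable section

/-- The plane `ℝ²`, carrier for measures on the unit square. -/
abbrev Ω2 : Type := ℝ × ℝ

/-- The unit square `[0,1]² ⊆ ℝ²`. -/
def unitSq : Set Ω2 := Set.Icc (0 : ℝ) 1 ×ˢ Set.Icc (0 : ℝ) 1

/-- Lebesgue measure on the unit square. -/
def lebSq : Measure Ω2 := volume.restrict unitSq

/-- `𝒫`: Borel probability measures concentrated on the unit square. -/
def Pcal : Set (ProbabilityMeasure Ω2) := {μ | (μ : Measure Ω2) unitSq = 1}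

/-- `ℳ`: members of `𝒫` whose two coordinate marginals are atomless
(equivalently, have continuous CDFs). -/
def Mcal : Set (ProbabilityMeasure Ω2) :=
  {μ | μ ∈ Pcal ∧ (∀ x : ℝ, (μ : Measure Ω2).map Prod.fst {x} = 0) ∧
      ∀ y : ℝ, (μ : Measure Ω2).map Prod.snd {y} = 0}

/-- The uniform distribution on `[0,1]`. -/
def unif01 : Measure ℝ := volume.restrict (Set.Icc (0 : ℝ) 1)

/-- `ℳ̃`: permutons, i.e. members of `𝒫` with both marginals uniform on `[0,1]`. -/
def Mtilde : Set (ProbabilityMeasure Ω2) :=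
  {μ | μ ∈ Pcal ∧ (μ : Measure Ω2).map Prod.fst = unif01 ∧
      (μ : Measure Ω2).map Prod.snd = unif01}

open scoped Classical in
/-- `h_σ`: indicator that the `k` points induce the pattern `σ`. -/
def hPat {k : ℕ} (σ : Equiv.Perm (Fin k)) (z : Fin k → Ω2) : ℝ :=
  if ∃ τ : Equiv.Perm (Fin k),
      StrictMono (fun i => (z (τ i)).1) ∧ StrictMono (fun i => (z (τ (σ⁻¹ i))).2)
  then 1 else 0

/-- Pattern density `t_σ(ν) = ∫ h_σ dν^{⊗k}`. -/
def tPat {k : ℕ} (σ : Equiv.Perm (Fin k)) (ν : Measure Ω2) : ℝ :=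
  ∫ z, hPat σ z ∂(Measure.pi fun _ : Fin k => ν)

open scoped Classical in
/-- The permutation induced by `n` labelled points of `ℝ²` (junk value `1` if the
coordinates are not in generic position). -/
def inducedPerm {n : ℕ} (z : Fin n → Ω2) : Equiv.Perm (Fin n) :=
  if h : ∃ σ : Equiv.Perm (Fin n), hPat σ z = 1 then h.choose else 1

/-- Empirical measure `Em(π) = (1/n) ∑ δ_{(i/n, π(i)/n)}` of a permutation, as a measure. -/
def EmM {n : ℕ} (π : Equiv.Perm (Fin n)) : Measure Ω2 :=
  (n : ℝ≥0∞)⁻¹ • ∑ i : Fin n, Measure.dirac ((((i : ℕ) + 1 : ℝ)) / n, (((π i : ℕ) + 1 : ℝ)) / n)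

open scoped Classical in
/-- Empirical measure of a permutation as a probability measure (junk value for `n = 0`). -/
def EmP {n : ℕ} (π : Equiv.Perm (Fin n)) : ProbabilityMeasure Ω2 :=
  if h : IsProbabilityMeasure (EmM π) then ⟨EmM π, h⟩
  else ⟨Measure.dirac 0, by infer_instance⟩

/-- `t_σ(π) := t_σ(Em(π))`. -/
def tPerm {k n : ℕ} (σ : Equiv.Perm (Fin k)) (π : Equiv.Perm (Fin n)) : ℝ := tPat σ (EmM π)

open scoped Classical in
/-- Kullback–Leibler divergence `D(ν|μ) ∈ [0,∞]`; for probability measures with `ν ≪ μ`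
it equals `∫ log(dν/dμ) dν`, written here through the nonnegative integrand
`g log g + 1 - g` of the density `g = dν/dμ` (the correction `∫ (1-g) dμ = 0`). -/
def KL (ν μ : Measure Ω2) : ℝ≥0∞ :=
  if ν ≪ μ then
    ∫⁻ z, ENNReal.ofReal ((ν.rnDeriv μ z).toReal * Real.log ((ν.rnDeriv μ z).toReal)
      + 1 - (ν.rnDeriv μ z).toReal) ∂μ
  else ∞

/-- CDF of the first marginal. -/
def cdfX (μ : Measure Ω2) (x : ℝ) : ℝ := (μ {p : Ω2 | p.1 ≤ x}).toReal

/-- CDF of the second marginal. -/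
def cdfY (μ : Measure Ω2) (y : ℝ) : ℝ := (μ {p : Ω2 | p.2 ≤ y}).toReal

/-- The map `𝒪`: pushforward of `μ` under `(x,y) ↦ (F₁(x), F₂(y))`. -/
def Omap (μ : Measure Ω2) : Measure Ω2 := μ.map fun p => (cdfX μ p.1, cdfY μ p.2)

/-- The product measure `μ^{⊗n}` governing `n` i.i.d. samples. -/
def pmeas (μ : Measure Ω2) (n : ℕ) : Measure (Fin n → Ω2) := Measure.pi fun _ => μ

/-- Log-partition function `F_n(σ,μ,θ) = log E[exp(nθ t_σ(π_{n,μ}))]`. -/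
def Fn {k : ℕ} (σ : Equiv.Perm (Fin k)) (μ : Measure Ω2) (θ : ℝ) (n : ℕ) : ℝ :=
  Real.log (∫ z, Real.exp (n * θ * tPerm σ (inducedPerm z)) ∂pmeas μ n)

/-- The Gibbs measure `Q_{n,σ,μ,θ}` on `([0,1]²)ⁿ`. -/
def Qgibbs {k : ℕ} (σ : Equiv.Perm (Fin k)) (μ : Measure Ω2) (θ : ℝ) (n : ℕ) :
    Measure (Fin n → Ω2) :=
  (pmeas μ n).withDensity fun z =>
    ENNReal.ofReal (Real.exp (n * θ * tPerm σ (inducedPerm z) - Fn σ μ θ n))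

/-- `F(σ,μ,θ) = sup_{ν ∈ ℳ} { θ t_σ(ν) − D(ν|μ) }`, valued in `EReal`. -/
def Fsup {k : ℕ} (σ : Equiv.Perm (Fin k)) (μ : Measure Ω2) (θ : ℝ) : EReal :=
  ⨆ ν ∈ Mcal, (((θ * tPat σ (ν : Measure Ω2) : ℝ) : EReal) - ((KL (↑ν) μ : ℝ≥0∞) : EReal))

/-- `ℱ(σ,μ,θ)`: the set of maximizers of `ν ↦ θ t_σ(ν) − D(ν|μ)` over `ℳ`. -/
def Fset {k : ℕ} (σ : Equiv.Perm (Fin k)) (μ : Measure Ω2) (θ : ℝ) :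
    Set (ProbabilityMeasure Ω2) :=
  {ν | ν ∈ Mcal ∧
    (((θ * tPat σ (ν : Measure Ω2) : ℝ) : EReal) - ((KL (↑ν) μ : ℝ≥0∞) : EReal)) = Fsup σ μ θ}

/-- `G(σ,μ,δ) = inf { D(ν|μ) : ν ∈ ℳ, t_σ(ν) ≥ δ }`. -/
def Gfun {k : ℕ} (σ : Equiv.Perm (Fin k)) (μ : Measure Ω2) (δ : ℝ) : ℝ≥0∞ :=
  ⨅ ν ∈ {ν : ProbabilityMeasure Ω2 | ν ∈ Mcal ∧ δ ≤ tPat σ (ν : Measure Ω2)}, KL (↑ν) μ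

/-- `𝒢(σ,μ,δ)`: the set of minimizers in the definition of `G(σ,μ,δ)`. -/
def Gset {k : ℕ} (σ : Equiv.Perm (Fin k)) (μ : Measure Ω2) (δ : ℝ) :
    Set (ProbabilityMeasure Ω2) :=
  {ν | (ν ∈ Mcal ∧ δ ≤ tPat σ (ν : Measure Ω2)) ∧ KL (↑ν) μ = Gfun σ μ δ}

/-- `α_σ(μ) = inf {δ : G(σ,μ,δ) = ∞}`. -/
def alphaSig {k : ℕ} (σ : Equiv.Perm (Fin k)) (μ : Measure Ω2) : ℝ :=
  sInf {δ : ℝ | Gfun σ μ δ = ∞}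

/-- `μ` is conditionally constant (CC) with respect to a pattern `σ` of size `k+1`:
the conditional probability `P(π_{X,Y} = σ | (X₁,Y₁))`, which for i.i.d. samples equals
`z ↦ ∫ h_σ(z, w) dμ^{⊗k}(w)`, is `μ`-a.s. equal to a constant `c ∈ [0,1]`. -/
def IsCC {k : ℕ} (σ : Equiv.Perm (Fin (k + 1))) (μ : Measure Ω2) : Prop :=
  ∃ c ∈ Set.Icc (0 : ℝ) 1, ∀ᵐ z ∂μ,
    (∫ w : Fin k → Ω2, hPat σ (Fin.cons z w) ∂pmeas μ k) = c

/-- The inversion pattern `21 ∈ S₂`. -/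
def inv2 : Equiv.Perm (Fin 2) := Equiv.swap 0 1

/-- Lévy–Prokhorov (extended) distance between measures on `ℝ²`. -/
def dLPE (μ ν : Measure Ω2) : ℝ≥0∞ := levyProkhorovEDist μ ν

/-- The topological support of a measure: the points whose every open neighbourhood
has positive measure. -/
def msupport (μ : Measure Ω2) : Set Ω2 :=
  {z | ∀ U : Set Ω2, IsOpen U → z ∈ U → 0 < μ U}


/-! ### Product measures and bounded functions -/

lemma integrable_of_abs_le {E : Type*} [MeasurableSpace E] {m : Measure E} [IsFiniteMeasure m]
    {f : E → ℝ} (hf : Measurable f) {C : ℝ} (hC : ∀ x, |f x| ≤ C) : Integrable f m :=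
  Integrable.of_bound hf.aestronglyMeasurable C (ae_of_all _ hC)

lemma abs_integral_le_of_abs_le {E : Type*} [MeasurableSpace E] {m : Measure E}
    [IsProbabilityMeasure m] {f : E → ℝ} {C : ℝ} (hC : ∀ x, |f x| ≤ C) : |∫ x, f x ∂m| ≤ C := by
  have := norm_integral_le_of_norm_le_const (μ := m) (f := f) (ae_of_all _ hC)
  simpa using this

lemma integral_nonneg_le_one {E : Type*} [MeasurableSpace E] {m : Measure E}
    [IsProbabilityMeasure m] {f : E → ℝ} (h0 : ∀ x, 0 ≤ f x) (h1 : ∀ x, f x ≤ 1) :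
    0 ≤ ∫ x, f x ∂m ∧ ∫ x, f x ∂m ≤ 1 :=
  ⟨integral_nonneg h0, (le_abs_self _).trans (abs_integral_le_of_abs_le
    (fun x => abs_le.2 ⟨by linarith [h0 x], h1 x⟩))⟩

section Pi

variable {E : Type*} [MeasurableSpace E]

lemma measurable_insertNth {n : ℕ} (i : Fin (n + 1)) :
    Measurable fun p : E × (Fin n → E) => (i.insertNth p.1 p.2 : Fin (n + 1) → E) :=
  (MeasurableEquiv.piFinSuccAbove (fun _ : Fin (n + 1) => E) i).symm.measurable

lemma measurable_cons {n : ℕ} :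
    Measurable fun p : E × (Fin n → E) => (Fin.cons p.1 p.2 : Fin (n + 1) → E) := by
  simpa only [Fin.insertNth_zero'] using measurable_insertNth (E := E) (n := n) 0

lemma integral_pi_insertNth {n : ℕ} (ρ : Fin (n + 1) → Measure E)
    [∀ i, IsProbabilityMeasure (ρ i)] (i : Fin (n + 1)) {g : (Fin (n + 1) → E) → ℝ}
    (hg : Measurable g) {C : ℝ} (hC : ∀ w, |g w| ≤ C) :
    ∫ w, g w ∂Measure.pi ρ =
      ∫ a, ∫ w, g (i.insertNth a w) ∂Measure.pi (fun j => ρ (i.succAbove j)) ∂ρ i := by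
  rw [← ((measurePreserving_piFinSuccAbove ρ i).symm).integral_comp']
  rw [integral_prod]
  · rfl
  · exact integrable_of_abs_le (hg.comp (measurable_insertNth i)) (fun _ => hC _)

lemma integral_pi_cons {n : ℕ} (ρ : Fin (n + 1) → Measure E)
    [∀ i, IsProbabilityMeasure (ρ i)] {g : (Fin (n + 1) → E) → ℝ}
    (hg : Measurable g) {C : ℝ} (hC : ∀ w, |g w| ≤ C) :
    ∫ w, g w ∂Measure.pi ρ =
      ∫ a, ∫ w, g (Fin.cons a w) ∂Measure.pi (fun j => ρ j.succ) ∂ρ 0 := by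
  rw [integral_pi_insertNth ρ 0 hg hC]
  simp only [Fin.insertNth_zero', Fin.zero_succAbove]

lemma measurable_integral_cons {n : ℕ} (ρ : Measure (Fin n → E)) [SFinite ρ]
    {g : (Fin (n + 1) → E) → ℝ} (hg : Measurable g) :
    Measurable fun a => ∫ w, g (Fin.cons a w) ∂ρ :=
  ((hg.comp measurable_cons).stronglyMeasurable.integral_prod_right').measurable

lemma measurable_integral_insertNth {n : ℕ} (i : Fin (n + 1)) (ρ : Measure (Fin n → E)) [SFinite ρ]
    {g : (Fin (n + 1) → E) → ℝ} (hg : Measurable g) :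
    Measurable fun a => ∫ w, g (i.insertNth a w) ∂ρ :=
  ((hg.comp (measurable_insertNth i)).stronglyMeasurable.integral_prod_right').measurable

lemma integral_map_of_measurable {F : Type*} [MeasurableSpace F] {m : Measure E} {φ : E → F}
    (hφ : Measurable φ) {g : F → ℝ} (hg : Measurable g) :
    ∫ y, g y ∂(m.map φ) = ∫ x, g (φ x) ∂m :=
  integral_map hφ.aemeasurable hg.aestronglyMeasurable

/-- If every section of `S` in the second variable has `ρ j`-mass at most `p`, then the event
`(w i, w j) ∈ S` has mass at most `p` under the product measure. -/
lemma pi_pair_le {n : ℕ} (ρ : Fin n → Measure E) [∀ i, IsProbabilityMeasure (ρ i)]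
    {i j : Fin n} (hij : i ≠ j) {S : Set (E × E)} (hS : MeasurableSet S) {p : ℝ≥0∞}
    (h : ∀ a, ρ j {b | (a, b) ∈ S} ≤ p) :
    Measure.pi ρ {w | (w i, w j) ∈ S} ≤ p := by
  cases n with
  | zero => exact i.elim0
  | succ n =>
    obtain ⟨i', rfl⟩ := Fin.exists_succAbove_eq hij
    have hm : MeasurableSet {q : E × (Fin n → E) | (q.2 i', q.1) ∈ S} :=
      hS.preimage (by fun_prop)
    have hpre : {w : Fin (n + 1) → E | (w (j.succAbove i'), w j) ∈ S} =
        (MeasurableEquiv.piFinSuccAbove (fun _ : Fin (n + 1) => E) j) ⁻¹'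
          {q : E × (Fin n → E) | (q.2 i', q.1) ∈ S} := by
      ext w; rfl
    rw [hpre, (measurePreserving_piFinSuccAbove ρ j).measure_preimage hm.nullMeasurableSet,
      Measure.prod_apply_symm hm]
    calc ∫⁻ y, (ρ j) ((fun x => (x, y)) ⁻¹' {q : E × (Fin n → E) | (q.2 i', q.1) ∈ S})
          ∂Measure.pi (fun k => ρ (j.succAbove k))
        ≤ ∫⁻ _, p ∂Measure.pi (fun k => ρ (j.succAbove k)) := lintegral_mono (fun y => h (y i'))
      _ = p := by simp

/-! ### Total variation and multilinear expansion -/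

/-- Integrals of measurable functions bounded by `1` against `ν` and `ρ` differ by at most `r`. -/
def TVBound (ν ρ : Measure E) (r : ℝ) : Prop :=
  ∀ f : E → ℝ, Measurable f → (∀ x, |f x| ≤ 1) → |∫ x, f x ∂ρ - ∫ x, f x ∂ν| ≤ r

lemma TVBound.nonneg {ν ρ : Measure E} {r : ℝ} (h : TVBound ν ρ r) : 0 ≤ r := by
  simpa using h (fun _ => 0) measurable_const (by simp)

lemma TVBound.scale {ν ρ : Measure E} {r : ℝ} (h : TVBound ν ρ r) {f : E → ℝ}
    (hf : Measurable f) {c : ℝ} (hc : 0 ≤ c) (hb : ∀ x, |f x| ≤ c) :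
    |∫ x, f x ∂ρ - ∫ x, f x ∂ν| ≤ c * r := by
  rcases hc.eq_or_lt with rfl | hc
  · have : f = fun _ => 0 := funext fun x => abs_nonpos_iff.1 (hb x)
    simp [this]
  · have := h (fun x => c⁻¹ * f x) (hf.const_mul _) (fun x => by
      rw [abs_mul, abs_of_pos (inv_pos.2 hc), inv_mul_le_one₀ hc]; exact hb x)
    rw [integral_const_mul, integral_const_mul, ← mul_sub, abs_mul, abs_of_pos (inv_pos.2 hc),
      inv_mul_le_iff₀ hc] at this
    exact this

lemma TVBound.eq_of_zero {ν ρ : Measure E} [IsFiniteMeasure ν] [IsFiniteMeasure ρ]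
    (h : TVBound ν ρ 0) : ρ = ν := by
  ext s hs
  have := h (s.indicator fun _ => 1) (measurable_const.indicator hs) (fun x => by
    by_cases hx : x ∈ s <;> simp [hx])
  rw [integral_indicator_const _ hs, integral_indicator_const _ hs] at this
  simp only [smul_eq_mul, mul_one, abs_nonpos_iff, sub_eq_zero] at this
  exact (measureReal_eq_measureReal_iff (measure_ne_top _ _) (measure_ne_top _ _)).1 this

lemma TVBound.pi_update {n : ℕ} {ν ρ : Measure E} [IsProbabilityMeasure ν]
    [IsProbabilityMeasure ρ] {r : ℝ} (h : TVBound ν ρ r) (i : Fin n) {g : (Fin n → E) → ℝ}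
    (hg : Measurable g) (hb : ∀ w, |g w| ≤ 1) :
    |∫ w, g w ∂Measure.pi (Function.update (fun _ : Fin n => ν) i ρ)
      - ∫ w, g w ∂Measure.pi (fun _ : Fin n => ν)| ≤ r := by
  cases n with
  | zero => exact i.elim0
  | succ n =>
    have : ∀ j, IsProbabilityMeasure (Function.update (fun _ : Fin (n + 1) => ν) i ρ j) := by
      intro j
      rcases eq_or_ne j i with rfl | hj
      · simpa
      · simpa [hj]
    rw [integral_pi_insertNth _ i hg hb, integral_pi_insertNth (fun _ => ν) i hg hb]
    simp only [Function.update_self, ne_eq, Fin.succAbove_ne, not_false_eq_true,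
      Function.update_of_ne]
    exact h _ (measurable_integral_insertNth i _ hg) (fun a => abs_integral_le_of_abs_le
      (fun w => hb _))

lemma TVBound.pi_sub_le {ν ρ : Measure E} [IsProbabilityMeasure ν]
    [IsProbabilityMeasure ρ] {r : ℝ} (h : TVBound ν ρ r) (n : ℕ) {g : (Fin n → E) → ℝ}
    (hg : Measurable g) (hb : ∀ w, |g w| ≤ 1) :
    |∫ w, g w ∂Measure.pi (fun _ : Fin n => ρ) - ∫ w, g w ∂Measure.pi (fun _ : Fin n => ν)|
      ≤ n * r := by
  induction n with
  | zero => simp [Subsingleton.elim (fun _ : Fin 0 => ρ) (fun _ => ν)]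
  | succ n ih =>
    rw [integral_pi_cons _ hg hb, integral_pi_cons (fun _ => ν) hg hb]
    set A := fun a => ∫ w, g (Fin.cons a w) ∂Measure.pi (fun _ : Fin n => ρ)
    set B := fun a => ∫ w, g (Fin.cons a w) ∂Measure.pi (fun _ : Fin n => ν)
    have hA : Measurable A := measurable_integral_cons _ hg
    have hB : Measurable B := measurable_integral_cons _ hg
    have hA1 : ∀ a, |A a| ≤ 1 := fun a => abs_integral_le_of_abs_le (fun w => hb _)
    have hB1 : ∀ a, |B a| ≤ 1 := fun a => abs_integral_le_of_abs_le (fun w => hb _)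
    have h1 : |∫ a, A a ∂ρ - ∫ a, B a ∂ρ| ≤ n * r := by
      rw [← integral_sub (integrable_of_abs_le hA hA1) (integrable_of_abs_le hB hB1)]
      refine abs_integral_le_of_abs_le (fun a => ih ?_ (fun w => hb _))
      exact hg.comp (measurable_cons.comp (measurable_const.prodMk measurable_id))
    have h2 := h B hB hB1
    calc |∫ a, A a ∂ρ - ∫ a, B a ∂ν|
        ≤ |∫ a, A a ∂ρ - ∫ a, B a ∂ρ| + |∫ a, B a ∂ρ - ∫ a, B a ∂ν| := abs_sub_le _ _ _
      _ ≤ n * r + r := add_le_add h1 h2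
      _ = ((n + 1 : ℕ) : ℝ) * r := by push_cast; ring

/-- Second-order expansion of `ρ ↦ ∫ g dρ^{⊗n}` around `ν`. -/
lemma TVBound.pi_taylor {ν ρ : Measure E} [IsProbabilityMeasure ν]
    [IsProbabilityMeasure ρ] {r : ℝ} (h : TVBound ν ρ r) (n : ℕ) {g : (Fin n → E) → ℝ}
    (hg : Measurable g) (hb : ∀ w, |g w| ≤ 1) :
    |∫ w, g w ∂Measure.pi (fun _ : Fin n => ρ) - ∫ w, g w ∂Measure.pi (fun _ : Fin n => ν)
      - ∑ i, (∫ w, g w ∂Measure.pi (Function.update (fun _ : Fin n => ν) i ρ)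
          - ∫ w, g w ∂Measure.pi (fun _ : Fin n => ν))| ≤ (n : ℝ) ^ 2 * r ^ 2 := by
  have hr := h.nonneg
  have hprob : ∀ (n : ℕ) (i j : Fin n),
      IsProbabilityMeasure (Function.update (fun _ : Fin n => ν) i ρ j) := by
    intro n i j
    rcases eq_or_ne j i with rfl | hj
    · simpa
    · simpa [hj]
  induction n with
  | zero => simp [Subsingleton.elim (fun _ : Fin 0 => ρ) (fun _ => ν)]
  | succ n ih =>
    have hgc : ∀ a : E, Measurable fun w : Fin n → E => g (Fin.cons a w) := fun a =>
      hg.comp (measurable_cons.comp (measurable_const.prodMk measurable_id))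
    rw [Fin.sum_univ_succ]
    have h0 : ∫ w, g w ∂Measure.pi (Function.update (fun _ : Fin (n + 1) => ν) 0 ρ) =
        ∫ a, ∫ w, g (Fin.cons a w) ∂Measure.pi (fun _ : Fin n => ν) ∂ρ := by
      rw [integral_pi_cons _ hg hb]; simp
    have hs : ∀ i : Fin n,
        ∫ w, g w ∂Measure.pi (Function.update (fun _ : Fin (n + 1) => ν) i.succ ρ) =
        ∫ a, ∫ w, g (Fin.cons a w) ∂Measure.pi (Function.update (fun _ : Fin n => ν) i ρ) ∂ν := by
      intro i
      rw [integral_pi_cons _ hg hb]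
      have : ∀ j : Fin n, Function.update (fun _ : Fin (n + 1) => ν) i.succ ρ j.succ =
          Function.update (fun _ : Fin n => ν) i ρ j := by
        intro j
        rcases eq_or_ne j i with rfl | hj
        · simp
        · simp [hj]
      simp_rw [this]
      rw [Function.update_of_ne (Fin.succ_ne_zero i).symm]
    rw [h0, integral_pi_cons _ hg hb, integral_pi_cons (fun _ => ν) hg hb]
    simp_rw [hs]
    set A := fun a => ∫ w, g (Fin.cons a w) ∂Measure.pi (fun _ : Fin n => ρ)
    set B := fun a => ∫ w, g (Fin.cons a w) ∂Measure.pi (fun _ : Fin n => ν)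
    set D := fun (i : Fin n) a =>
      ∫ w, g (Fin.cons a w) ∂Measure.pi (Function.update (fun _ : Fin n => ν) i ρ)
    have hA : Measurable A := measurable_integral_cons _ hg
    have hB : Measurable B := measurable_integral_cons _ hg
    have hD : ∀ i, Measurable (D i) := fun i => measurable_integral_cons _ hg
    have hA1 : ∀ a, |A a| ≤ 1 := fun a => abs_integral_le_of_abs_le (fun w => hb _)
    have hB1 : ∀ a, |B a| ≤ 1 := fun a => abs_integral_le_of_abs_le (fun w => hb _)
    have hD1 : ∀ i a, |D i a| ≤ 1 := fun i a => abs_integral_le_of_abs_le (fun w => hb _)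
    set S := fun a => ∑ i, (D i a - B a)
    have hS : Measurable S := Finset.measurable_sum _ (fun i _ => (hD i).sub hB)
    have hS1 : ∀ a, |S a| ≤ n * r := fun a => by
      refine (Finset.abs_sum_le_sum_abs _ _).trans ?_
      refine (Finset.sum_le_sum (fun i _ => h.pi_update i (hgc a) (fun w => hb _))).trans ?_
      simp
    have hI : ∀ (m : Measure E) [IsProbabilityMeasure m] {f : E → ℝ} {c : ℝ}, Measurable f →
      (∀ a, |f a| ≤ c) → Integrable f m := fun m _ f c hf hc => integrable_of_abs_le hf hc
    have e1 : ∑ i, (∫ a, D i a ∂ν - ∫ a, B a ∂ν) = ∫ a, S a ∂ν := by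
      have hDB : ∀ i, Integrable (fun a => D i a - B a) ν :=
        fun i => (hI ν (hD i) (hD1 i)).sub (hI ν hB hB1)
      rw [integral_finsetSum _ (fun i _ => hDB i)]
      exact Finset.sum_congr rfl fun i _ =>
        (integral_sub (hI ν (hD i) (hD1 i)) (hI ν hB hB1)).symm
    have e2 : ∫ a, (A a - B a - S a) ∂ρ = ∫ a, A a ∂ρ - ∫ a, B a ∂ρ - ∫ a, S a ∂ρ := by
      have hAB : Integrable (fun a => A a - B a) ρ := (hI ρ hA hA1).sub (hI ρ hB hB1)
      rw [integral_sub hAB (hI ρ hS hS1),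
        integral_sub (hI ρ hA hA1) (hI ρ hB hB1)]
    rw [e1]
    have h1 : |∫ a, (A a - B a - S a) ∂ρ| ≤ (n : ℝ) ^ 2 * r ^ 2 :=
      abs_integral_le_of_abs_le (fun a => ih (hgc a) (fun w => hb _))
    have h2 := h.scale hS (by positivity) hS1
    have : ∫ a, A a ∂ρ - ∫ a, B a ∂ν - (∫ a, B a ∂ρ - ∫ a, B a ∂ν + ∫ a, S a ∂ν) =
      ∫ a, (A a - B a - S a) ∂ρ + (∫ a, S a ∂ρ - ∫ a, S a ∂ν) := by rw [e2]; ring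
    rw [this]
    refine (abs_add_le _ _).trans ((add_le_add h1 h2).trans ?_)
    push_cast
    nlinarith [mul_nonneg (Nat.cast_nonneg (α := ℝ) n) (sq_nonneg r), sq_nonneg r]

end Pi

/-! ### Pattern densities -/

section Pattern

variable {k : ℕ}

lemma hPat_eq_one_iff (σ : Equiv.Perm (Fin k)) (z : Fin k → Ω2) :
    hPat σ z = 1 ↔ ∃ τ : Equiv.Perm (Fin k),
      StrictMono (fun i => (z (τ i)).1) ∧ StrictMono (fun i => (z (τ (σ⁻¹ i))).2) := by
  unfold hPat; split_ifs with h
  · exact ⟨fun _ => h, fun _ => rfl⟩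
  · exact ⟨fun h0 => absurd h0 zero_ne_one, fun h' => absurd h' h⟩

lemma hPat_nonneg (σ : Equiv.Perm (Fin k)) (z : Fin k → Ω2) : 0 ≤ hPat σ z := by
  unfold hPat; split_ifs <;> simp

lemma hPat_le_one (σ : Equiv.Perm (Fin k)) (z : Fin k → Ω2) : hPat σ z ≤ 1 := by
  unfold hPat; split_ifs <;> simp

lemma hPat_abs_le (σ : Equiv.Perm (Fin k)) (z : Fin k → Ω2) : |hPat σ z| ≤ 1 :=
  abs_le.2 ⟨by linarith [hPat_nonneg σ z], hPat_le_one σ z⟩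

lemma hPat_eq_zero_of_ne_one {σ : Equiv.Perm (Fin k)} {z : Fin k → Ω2} (h : hPat σ z ≠ 1) :
    hPat σ z = 0 := by
  unfold hPat at *; split_ifs at * <;> simp_all

lemma measurableSet_strictMono {α ι : Type*} [MeasurableSpace α] [Preorder ι] [Countable ι]
    {f : ι → α → ℝ} (hf : ∀ i, Measurable (f i)) :
    MeasurableSet {x | StrictMono fun i => f i x} := by
  have : {x | StrictMono fun i => f i x} = ⋂ (a : ι) (b : ι) (_ : a < b), {x | f a x < f b x} := by
    ext x; simp [StrictMono]
  rw [this]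
  exact MeasurableSet.iInter fun a => MeasurableSet.iInter fun b => MeasurableSet.iInter fun _ =>
    measurableSet_lt (hf a) (hf b)

lemma measurable_hPat (σ : Equiv.Perm (Fin k)) : Measurable (hPat σ) := by
  unfold hPat
  refine Measurable.ite ?_ measurable_const measurable_const
  have : {z : Fin k → Ω2 | ∃ τ : Equiv.Perm (Fin k),
      StrictMono (fun i => (z (τ i)).1) ∧ StrictMono (fun i => (z (τ (σ⁻¹ i))).2)} =
    ⋃ τ : Equiv.Perm (Fin k), {z | StrictMono (fun i => (z (τ i)).1)} ∩
      {z | StrictMono (fun i => (z (τ (σ⁻¹ i))).2)} := by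
    ext z; simp
  rw [this]
  exact MeasurableSet.iUnion fun τ =>
    (measurableSet_strictMono (fun i => (measurable_pi_apply (τ i)).fst)).inter
    (measurableSet_strictMono (fun i => (measurable_pi_apply (τ (σ⁻¹ i))).snd))

lemma hPat_comp_perm (σ e : Equiv.Perm (Fin k)) (z : Fin k → Ω2) :
    hPat σ (z ∘ e) = hPat σ z := by
  have key : ∀ (e : Equiv.Perm (Fin k)) (z : Fin k → Ω2), hPat σ z = 1 → hPat σ (z ∘ e) = 1 := by
    intro e z h
    obtain ⟨τ, h1, h2⟩ := (hPat_eq_one_iff σ z).1 h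
    refine (hPat_eq_one_iff σ _).2 ⟨τ.trans e.symm, ?_, ?_⟩
    · simpa using h1
    · simpa using h2
  by_cases h : hPat σ z = 1
  · rw [key e z h, h]
  · have h' : hPat σ (z ∘ e) ≠ 1 := fun h' => h (by
      simpa [Function.comp_assoc] using key e.symm _ h')
    rw [hPat_eq_zero_of_ne_one h, hPat_eq_zero_of_ne_one h']

lemma tPat_le_one (σ : Equiv.Perm (Fin k)) (ν : Measure Ω2) [IsProbabilityMeasure ν] :
    tPat σ ν ≤ 1 :=
  (integral_nonneg_le_one (hPat_nonneg σ) (hPat_le_one σ)).2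

lemma TVBound.tPat_sub_le {ν ρ : Measure Ω2} [IsProbabilityMeasure ν] [IsProbabilityMeasure ρ]
    {r : ℝ} (h : TVBound ν ρ r) (σ : Equiv.Perm (Fin k)) : |tPat σ ρ - tPat σ ν| ≤ k * r :=
  h.pi_sub_le k (measurable_hPat σ) (hPat_abs_le σ)

lemma tPat_map {ν : Measure Ω2} [IsProbabilityMeasure ν] {φ : Ω2 → Ω2} (hφ : Measurable φ)
    (σ : Equiv.Perm (Fin k)) :
    tPat σ (ν.map φ) = ∫ w, hPat σ (fun i => φ (w i)) ∂Measure.pi (fun _ : Fin k => ν) := by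
  have : IsProbabilityMeasure (ν.map φ) := Measure.isProbabilityMeasure_map hφ.aemeasurable
  unfold tPat
  rw [← Measure.pi_map_pi (fun _ => hφ.aemeasurable)]
  exact integral_map_of_measurable (measurable_pi_lambda _
    fun i => hφ.comp (measurable_pi_apply i)) (measurable_hPat σ)

/-- The conditional pattern probability given one of the points. -/
def hCond (σ : Equiv.Perm (Fin (k + 1))) (ν : Measure Ω2) (z : Ω2) : ℝ :=
  ∫ w : Fin k → Ω2, hPat σ (Fin.cons z w) ∂pmeas ν k

instance (ν : Measure Ω2) [IsProbabilityMeasure ν] (n : ℕ) : IsProbabilityMeasure (pmeas ν n) := by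
  unfold pmeas; infer_instance

variable (σ : Equiv.Perm (Fin (k + 1)))

lemma measurable_hCond (ν : Measure Ω2) [IsProbabilityMeasure ν] : Measurable (hCond σ ν) :=
  measurable_integral_cons _ (measurable_hPat σ)

lemma hCond_nonneg (ν : Measure Ω2) (z : Ω2) : 0 ≤ hCond σ ν z :=
  integral_nonneg (fun _ => hPat_nonneg σ _)

lemma hCond_le_one (ν : Measure Ω2) [IsProbabilityMeasure ν] (z : Ω2) : hCond σ ν z ≤ 1 :=
  (integral_nonneg_le_one (fun _ => hPat_nonneg σ _) (fun _ => hPat_le_one σ _)).2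

lemma hCond_abs_le (ν : Measure Ω2) [IsProbabilityMeasure ν] (z : Ω2) : |hCond σ ν z| ≤ 1 :=
  abs_le.2 ⟨by linarith [hCond_nonneg σ ν z], hCond_le_one σ ν z⟩

lemma integral_hPat_cons (ν ρ : Measure Ω2) [IsProbabilityMeasure ν] [IsProbabilityMeasure ρ] :
    ∫ w, hPat σ w ∂Measure.pi (Fin.cons ρ (fun _ => ν) : Fin (k + 1) → Measure Ω2) =
      ∫ z, hCond σ ν z ∂ρ := by
  have : ∀ i, IsProbabilityMeasure
      ((Fin.cons ρ (fun _ => ν) : Fin (k + 1) → Measure Ω2) i) := by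
    intro i; cases i using Fin.cases <;> simpa
  rw [integral_pi_cons _ (measurable_hPat σ) (hPat_abs_le σ)]
  simp [hCond, pmeas]

lemma tPat_eq_integral_hCond (ν : Measure Ω2) [IsProbabilityMeasure ν] :
    tPat σ ν = ∫ z, hCond σ ν z ∂ν := by
  unfold tPat
  rw [integral_pi_cons _ (measurable_hPat σ) (hPat_abs_le σ)]
  simp [hCond, pmeas]

lemma integral_hPat_update (ν ρ : Measure Ω2) [IsProbabilityMeasure ν] [IsProbabilityMeasure ρ]
    (i : Fin (k + 1)) :
    ∫ w, hPat σ w ∂Measure.pi (Function.update (fun _ : Fin (k + 1) => ν) i ρ) =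
      ∫ z, hCond σ ν z ∂ρ := by
  have : ∀ j, IsProbabilityMeasure (Function.update (fun _ : Fin (k + 1) => ν) i ρ j) := by
    intro j
    rcases eq_or_ne j i with rfl | hj
    · simpa
    · simpa [hj]
  rw [integral_pi_insertNth _ i (measurable_hPat σ) (hPat_abs_le σ)]
  simp only [Function.update_self, ne_eq, Fin.succAbove_ne, not_false_eq_true,
    Function.update_of_ne, hCond, pmeas, ← Fin.cons_comp_cycleRange, hPat_comp_perm]

/-- Second-order remainder of the pattern density `ρ ↦ t_σ(ρ)` around `ν`. -/
def tRem (ν ρ : Measure Ω2) : ℝ :=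
  tPat σ ρ - tPat σ ν - (k + 1) * (∫ z, hCond σ ν z ∂ρ - tPat σ ν)

lemma TVBound.abs_tRem_le {ν ρ : Measure Ω2} [IsProbabilityMeasure ν] [IsProbabilityMeasure ρ]
    {r : ℝ} (h : TVBound ν ρ r) : |tRem σ ν ρ| ≤ (k + 1) ^ 2 * r ^ 2 := by
  have := h.pi_taylor (k + 1) (measurable_hPat σ) (hPat_abs_le σ)
  simp only [integral_hPat_update] at this
  rw [Finset.sum_const] at this
  simpa [tRem, tPat] using this

lemma TVBound.hCond_sub_le {ν ρ : Measure Ω2} [IsProbabilityMeasure ν] [IsProbabilityMeasure ρ]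
    {r : ℝ} (h : TVBound ν ρ r) (z : Ω2) : |hCond σ ρ z - hCond σ ν z| ≤ k * r :=
  h.pi_sub_le k ((measurable_hPat σ).comp (measurable_cons.comp
    (measurable_const.prodMk measurable_id))) (fun _ => hPat_abs_le σ _)

end Pattern

/-! ### Exponential tilts and relative entropy -/

lemma abs_exp_sub_exp_le {a b : ℝ} (ha : |a| ≤ 1) (hb : |b| ≤ 1) :
    |Real.exp a - Real.exp b| ≤ 3 * |a - b| := by
  have h3 : Real.exp 1 ≤ 3 := Real.exp_one_lt_three.le
  have key : ∀ a b : ℝ, |a| ≤ 1 → Real.exp a - Real.exp b ≤ 3 * |a - b| := by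
    intro a b ha
    have h1 := Real.add_one_le_exp (b - a)
    have h2 : Real.exp b = Real.exp a * Real.exp (b - a) := by rw [← Real.exp_add]; ring_nf
    have h4 : Real.exp a ≤ 3 := (Real.exp_le_exp.2 (abs_le.1 ha).2).trans h3
    have h5 := Real.exp_pos a
    have h6 := le_abs_self (a - b)
    have h7 := abs_nonneg (a - b)
    calc Real.exp a - Real.exp b ≤ Real.exp a * (a - b) := by rw [h2]; nlinarith
      _ ≤ Real.exp a * |a - b| := by gcongr
      _ ≤ 3 * |a - b| := by gcongr
  refine abs_sub_le_iff.2 ⟨key a b ha, ?_⟩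
  rw [abs_sub_comm]; exact key b a hb

section Tilt

variable {E : Type*} [MeasurableSpace E] {μ : Measure E} [IsProbabilityMeasure μ]

lemma integrable_exp_of_abs_le {a : E → ℝ} (ha : Measurable a) {C : ℝ} (hC : ∀ x, |a x| ≤ C) :
    Integrable (fun x => Real.exp (a x)) μ :=
  integrable_of_abs_le ha.exp (C := Real.exp C) fun x => by
    rw [abs_of_pos (Real.exp_pos _)]; exact Real.exp_le_exp.2 (abs_le.1 (hC x)).2

lemma tvBound_tilted {a b : E → ℝ} (ha : Measurable a) (hb : Measurable b)
    (ha1 : ∀ x, |a x| ≤ 1) (hb1 : ∀ x, |b x| ≤ 1) {d : ℝ} (hd : ∀ x, |b x - a x| ≤ d) :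
    TVBound (μ.tilted a) (μ.tilted b) (18 * d) := by
  intro φ hφ hφ1
  have hform : ∀ (c : E → ℝ), ∫ x, φ x ∂μ.tilted c =
      (∫ x, φ x * Real.exp (c x) ∂μ) / ∫ x, Real.exp (c x) ∂μ := by
    intro c
    rw [integral_tilted, ← integral_div]
    congr 1; ext x; simp only [smul_eq_mul]; ring
  have hIa := integrable_exp_of_abs_le (μ := μ) ha ha1
  have hIb := integrable_exp_of_abs_le (μ := μ) hb hb1
  have hle : ∀ c : E → ℝ, (∀ x, |c x| ≤ 1) → ∀ x, |φ x * Real.exp (c x)| ≤ Real.exp 1 := by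
    intro c hc x
    rw [abs_mul, abs_of_pos (Real.exp_pos _)]
    calc |φ x| * Real.exp (c x) ≤ 1 * Real.exp 1 := by
          gcongr
          · exact hφ1 x
          · exact (abs_le.1 (hc x)).2
      _ = Real.exp 1 := one_mul _
  have hJa : Integrable (fun x => φ x * Real.exp (a x)) μ :=
    integrable_of_abs_le (hφ.mul ha.exp) (hle a ha1)
  have hJb : Integrable (fun x => φ x * Real.exp (b x)) μ :=
    integrable_of_abs_le (hφ.mul hb.exp) (hle b hb1)
  have hd' : ∀ x, |Real.exp (b x) - Real.exp (a x)| ≤ 3 * d := fun x =>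
    (abs_exp_sub_exp_le (hb1 x) (ha1 x)).trans (by gcongr; exact hd x)
  have hA : 1 / 3 ≤ ∫ x, Real.exp (a x) ∂μ := by
    have h1 : (1 : ℝ) / 3 ≤ Real.exp (-1) := by
      rw [Real.exp_neg, one_div]
      exact inv_anti₀ (Real.exp_pos _) Real.exp_one_lt_three.le
    calc (1 : ℝ) / 3 ≤ ∫ _, Real.exp (-1) ∂μ := by simpa using h1
      _ ≤ _ := integral_mono (integrable_const _) hIa
          (fun x => Real.exp_le_exp.2 (abs_le.1 (ha1 x)).1)
  have hB : 0 < ∫ x, Real.exp (b x) ∂μ := integral_exp_pos hIb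
  have hN : |∫ x, φ x * Real.exp (b x) ∂μ - ∫ x, φ x * Real.exp (a x) ∂μ| ≤ 3 * d := by
    rw [← integral_sub hJb hJa]
    refine abs_integral_le_of_abs_le fun x => ?_
    rw [← mul_sub, abs_mul]
    calc _ ≤ 1 * (3 * d) := mul_le_mul (hφ1 x) (hd' x) (abs_nonneg _) zero_le_one
      _ = 3 * d := one_mul _
  have hZ : |∫ x, Real.exp (a x) ∂μ - ∫ x, Real.exp (b x) ∂μ| ≤ 3 * d := by
    rw [abs_sub_comm, ← integral_sub hIb hIa]
    exact abs_integral_le_of_abs_le hd'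
  have hM : |(∫ x, φ x * Real.exp (b x) ∂μ) / ∫ x, Real.exp (b x) ∂μ| ≤ 1 := by
    rw [← hform]
    have := isProbabilityMeasure_tilted hIb
    exact abs_integral_le_of_abs_le hφ1
  rw [hform, hform]
  set A := ∫ x, Real.exp (a x) ∂μ
  set B := ∫ x, Real.exp (b x) ∂μ
  set N := ∫ x, φ x * Real.exp (b x) ∂μ
  set M := ∫ x, φ x * Real.exp (a x) ∂μ
  have hA0 : 0 < A := by linarith
  have : N / B - M / A = ((N - M) + (N / B) * (A - B)) / A := by field_simp; ring
  rw [this, abs_div, abs_of_pos hA0, div_le_iff₀ hA0]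
  have hd0 : 0 ≤ 3 * d := (abs_nonneg _).trans hN
  calc |N - M + N / B * (A - B)| ≤ |N - M| + |N / B| * |A - B| := by
        rw [← abs_mul]; exact abs_add_le _ _
    _ ≤ 3 * d + 1 * (3 * d) := by gcongr
    _ ≤ 18 * d * A := by nlinarith

end Tilt

/-- The mean-field equation has a solution for small `θ`. -/
lemma exists_tilted_fixedPoint {k : ℕ} (σ : Equiv.Perm (Fin (k + 1))) (μ : Measure Ω2)
    [IsProbabilityMeasure μ] {θ : ℝ} (hθ : |θ| * (k + 1) ^ 2 ≤ 1 / 100) :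
    ∃ ν : Measure Ω2, IsProbabilityMeasure ν ∧
      ν = μ.tilted (fun z => θ * (k + 1) * hCond σ ν z) := by
  set s : ℝ := θ * (k + 1) with hs
  have hk : (0 : ℝ) ≤ k := Nat.cast_nonneg k
  have hs' : |s| * (k + 1) ≤ 1 / 100 := by
    rw [hs, abs_mul, abs_of_nonneg (by positivity : (0 : ℝ) ≤ k + 1)]; linarith
  have hs1 : |s| ≤ 1 := by nlinarith [abs_nonneg s]
  let Γ : (Ω2 → ℝ) → Ω2 → ℝ := fun g => hCond σ (μ.tilted fun z => s * g z)
  let P : (Ω2 → ℝ) → Prop := fun g => Measurable g ∧ ∀ z, |g z| ≤ 1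
  have hsg : ∀ g, P g → ∀ z, |s * g z| ≤ 1 := by
    intro g hg z
    rw [abs_mul]; exact mul_le_one₀ hs1 (abs_nonneg _) (hg.2 z)
  have hprob : ∀ g, P g → IsProbabilityMeasure (μ.tilted fun z => s * g z) := fun g hg =>
    isProbabilityMeasure_tilted (integrable_exp_of_abs_le (hg.1.const_mul s) (hsg g hg))
  have hΓP : ∀ g, P g → P (Γ g) := by
    intro g hg
    have := hprob g hg
    exact ⟨measurable_hCond σ _, hCond_abs_le σ _⟩
  have hΓ : ∀ g g' d, P g → P g' → (∀ z, |g' z - g z| ≤ d) → ∀ z, |Γ g' z - Γ g z| ≤ d / 2 := by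
    intro g g' d hg hg' hd z
    have h1 := hprob g hg
    have h2 := hprob g' hg'
    have htv := tvBound_tilted (μ := μ) (hg.1.const_mul s) (hg'.1.const_mul s) (hsg g hg)
      (hsg g' hg') (d := |s| * d) (fun x => by
        rw [← mul_sub, abs_mul]; gcongr; exact hd x)
    have hd0 : 0 ≤ d := (abs_nonneg _).trans (hd z)
    refine (htv.hCond_sub_le σ z).trans ?_
    nlinarith [mul_nonneg (abs_nonneg s) hd0]
  let g : ℕ → Ω2 → ℝ := fun n => Γ^[n] 0
  have hg_succ : ∀ n, g (n + 1) = Γ (g n) := fun n => Function.iterate_succ_apply' _ _ _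
  have hgP : ∀ n, P (g n) := by
    intro n
    induction n with
    | zero => exact ⟨measurable_zero, fun z => by simp [g]⟩
    | succ n ih => rw [hg_succ]; exact hΓP _ ih
  have hdist : ∀ n z, |g (n + 1) z - g n z| ≤ 1 * (1 / 2) ^ n := by
    intro n
    induction n with
    | zero => intro z; simpa [g] using (hΓP 0 (hgP 0)).2 z
    | succ n ih =>
      intro z
      rw [hg_succ (n + 1), hg_succ n] at *
      have := hΓ _ _ _ (hgP n) (hΓP _ (hgP n)) ih z
      rw [pow_succ]; linarith
  have hdist' : ∀ z n, dist (g n z) (g (n + 1) z) ≤ 1 * (1 / 2) ^ n := fun z n => by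
    rw [dist_comm, Real.dist_eq]; exact hdist n z
  have hlim : ∀ z, ∃ l, Tendsto (fun n => g n z) atTop (𝓝 l) := fun z =>
    cauchySeq_tendsto_of_complete (cauchySeq_of_le_geometric _ _ (by norm_num) (hdist' z))
  choose G hG using hlim
  have hGm : Measurable G := measurable_of_tendsto_metrizable (fun n => (hgP n).1)
    (tendsto_pi_nhds.2 hG)
  have hGP : P G := ⟨hGm, fun z => le_of_tendsto (hG z).abs (Eventually.of_forall
    fun n => (hgP n).2 z)⟩
  have hGd : ∀ n z, |G z - g n z| ≤ 2 * (1 / 2) ^ n := by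
    intro n z
    have := dist_le_of_le_geometric_of_tendsto _ _ (by norm_num) (hdist' z) (hG z) n
    rw [dist_comm, Real.dist_eq] at this
    refine this.trans (le_of_eq ?_)
    ring
  have hfix : Γ G = G := by
    ext z
    refine tendsto_nhds_unique (f := fun n => g (n + 1) z) ?_ ((tendsto_add_atTop_iff_nat 1).2 (hG z))
    rw [tendsto_iff_norm_sub_tendsto_zero]
    refine squeeze_zero (fun n => norm_nonneg _) (g := fun n => (1 / 2 : ℝ) ^ n) (fun n => ?_)
      (tendsto_pow_atTop_nhds_zero_of_lt_one (by norm_num) (by norm_num))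
    rw [hg_succ, Real.norm_eq_abs, abs_sub_comm]
    refine (hΓ _ _ _ (hgP n) hGP (hGd n) z).trans (by linarith)
  refine ⟨μ.tilted fun z => s * G z, hprob G hGP, ?_⟩
  have : hCond σ (μ.tilted fun z => s * G z) = G := hfix
  rw [this]

section Entropy

variable {μ ν ρ : Measure Ω2} {u : Ω2 → ℝ}

lemma integral_withDensity_exp (hu : Measurable u)
    (hν : ν = μ.withDensity fun z => ENNReal.ofReal (Real.exp (u z))) (φ : Ω2 → ℝ) :
    ∫ z, φ z ∂ν = ∫ z, Real.exp (u z) * φ z ∂μ := by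
  rw [hν, integral_withDensity_eq_integral_toReal_smul (by fun_prop)
    (ae_of_all _ fun _ => ENNReal.ofReal_lt_top)]
  simp only [ENNReal.toReal_ofReal (Real.exp_pos _).le, smul_eq_mul]

lemma KL_withDensity_exp [IsProbabilityMeasure μ] [IsProbabilityMeasure ν] (hu : Measurable u) {C : ℝ} (hC : ∀ z, |u z| ≤ C)
    (hν : ν = μ.withDensity fun z => ENNReal.ofReal (Real.exp (u z))) :
    KL ν μ = ENNReal.ofReal (∫ z, u z ∂ν) ∧ 0 ≤ ∫ z, u z ∂ν := by
  have hac : ν ≪ μ := hν ▸ withDensity_absolutelyContinuous _ _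
  have hrn : ν.rnDeriv μ =ᵐ[μ] fun z => ENNReal.ofReal (Real.exp (u z)) := by
    rw [hν]; exact Measure.rnDeriv_withDensity _ (by fun_prop)
  have hIe := integrable_exp_of_abs_le (μ := μ) hu hC
  have hIue : Integrable (fun z => Real.exp (u z) * u z) μ := by
    refine integrable_of_abs_le (hu.exp.mul hu) (C := Real.exp C * C) fun z => ?_
    rw [abs_mul, abs_of_pos (Real.exp_pos _)]
    exact mul_le_mul (Real.exp_le_exp.2 (abs_le.1 (hC z)).2) (hC z) (abs_nonneg _)
      (Real.exp_pos _).le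
  have hone : ∫ z, Real.exp (u z) ∂μ = 1 := by
    have := integral_withDensity_exp hu hν (fun _ => 1)
    simpa using this.symm
  have hpos : ∀ z, 0 ≤ Real.exp (u z) * u z + 1 - Real.exp (u z) := by
    intro z
    have h1 := Real.add_one_le_exp (-u z)
    have h2 : Real.exp (u z) * Real.exp (-u z) = 1 := by rw [← Real.exp_add]; simp
    nlinarith [Real.exp_pos (u z)]
  have hI1 : Integrable (fun z => Real.exp (u z) * u z + 1) μ := hIue.add (integrable_const 1)
  have hI2 : Integrable (fun z => Real.exp (u z) * u z + 1 - Real.exp (u z)) μ := hI1.sub hIe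
  have hval : ∫ z, (Real.exp (u z) * u z + 1 - Real.exp (u z)) ∂μ = ∫ z, u z ∂ν := by
    rw [integral_sub hI1 hIe, integral_add hIue (integrable_const 1),
      integral_withDensity_exp hu hν, hone]
    simp
  refine ⟨?_, hval ▸ integral_nonneg hpos⟩
  rw [KL, if_pos hac, ← hval, ofReal_integral_eq_lintegral_ofReal hI2 (ae_of_all _ hpos)]
  refine lintegral_congr_ae ?_
  filter_upwards [hrn] with z hz
  rw [hz, ENNReal.toReal_ofReal (Real.exp_pos _).le, Real.log_exp]

lemma entropy_integrand_ge {g : ℝ} (hg : 0 ≤ g) (v : ℝ) :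
    (√g - √(Real.exp v)) ^ 2 + g * v + 1 - Real.exp v ≤ g * Real.log g + 1 - g := by
  rcases hg.eq_or_lt with rfl | hg
  · have := Real.sq_sqrt (Real.exp_pos v).le
    simp; linarith
  · set a := √g
    set b := √(Real.exp v)
    have ha : 0 < a := Real.sqrt_pos.2 hg
    have hb : 0 < b := Real.sqrt_pos.2 (Real.exp_pos v)
    have ha2 : g = a ^ 2 := (Real.sq_sqrt hg.le).symm
    have hb2 : Real.exp v = b ^ 2 := (Real.sq_sqrt (Real.exp_pos v).le).symm
    have hv : v = 2 * Real.log b := by rw [← Real.log_exp v, hb2, Real.log_pow]; norm_num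
    have hl : Real.log g = 2 * Real.log a := by rw [ha2, Real.log_pow]; norm_num
    have h1 : Real.log b - Real.log a ≤ b / a - 1 := by
      rw [← Real.log_div hb.ne' ha.ne']; exact Real.log_le_sub_one_of_pos (by positivity)
    have h2 : a ^ 2 * (Real.log b - Real.log a) ≤ a * b - a ^ 2 := by
      calc a ^ 2 * (Real.log b - Real.log a) ≤ a ^ 2 * (b / a - 1) := by gcongr
        _ = a * b - a ^ 2 := by field_simp
    rw [hl, hb2, hv, ha2]
    nlinarith

lemma le_two_sqrt_of_forall {x H : ℝ} (hH : 0 ≤ H) (h : ∀ s > 0, x ≤ H / (2 * s) + 2 * s) :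
    x ≤ 2 * √H := by
  rcases hH.eq_or_lt with rfl | hH
  · simp only [zero_div, zero_add] at h
    simp only [Real.sqrt_zero, mul_zero]
    exact le_of_forall_pos_le_add fun e he => by linarith [h (e / 2) (by linarith)]
  · have hs : 0 < √H := Real.sqrt_pos.2 hH
    have := h (√H / 2) (by linarith)
    have e : H / (2 * (√H / 2)) = √H := by
      rw [div_eq_iff (by positivity)]
      nlinarith [Real.sq_sqrt hH.le]
    linarith

/-- Pinsker-type lower bound on the relative entropy in terms of an exponential tilt `ν`. -/
lemma exists_tvBound_of_KL [IsProbabilityMeasure μ] [IsProbabilityMeasure ν]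
    [IsProbabilityMeasure ρ] (hu : Measurable u) {C : ℝ} (hC : ∀ z, |u z| ≤ C)
    (hν : ν = μ.withDensity fun z => ENNReal.ofReal (Real.exp (u z))) (hρ : KL ρ μ ≠ ∞) :
    ∃ r, TVBound ν ρ r ∧ ∫ z, u z ∂ρ + r ^ 2 / 4 ≤ (KL ρ μ).toReal := by
  have hac : ρ ≪ μ := by
    by_contra h; exact hρ (by rw [KL, if_neg h])
  set g : Ω2 → ℝ := fun z => (ρ.rnDeriv μ z).toReal with hgdef
  have hgm : Measurable g := (Measure.measurable_rnDeriv _ _).ennreal_toReal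
  have hg0 : ∀ z, 0 ≤ g z := fun z => ENNReal.toReal_nonneg
  have hIg : Integrable g μ := Measure.integrable_toReal_rnDeriv
  have hgone : ∫ z, g z ∂μ = 1 := by
    have := Measure.integral_toReal_rnDeriv hac
    simpa using this
  have hint : ∀ φ : Ω2 → ℝ, ∫ z, φ z ∂ρ = ∫ z, g z * φ z ∂μ := fun φ => by
    have := integral_rnDeriv_smul hac (f := φ)
    simpa using this.symm
  have hIe := integrable_exp_of_abs_le (μ := μ) hu hC
  have hone : ∫ z, Real.exp (u z) ∂μ = 1 := by
    have := integral_withDensity_exp hu hν (fun _ => 1)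
    simpa using this.symm
  have hφ0 : ∀ z, 0 ≤ g z * Real.log (g z) + 1 - g z := by
    intro z
    have := entropy_integrand_ge (hg0 z) 0
    simp only [Real.exp_zero, Real.sqrt_one, mul_zero, add_zero] at this
    nlinarith [sq_nonneg (√(g z) - 1)]
  have hKL : KL ρ μ = ∫⁻ z, ENNReal.ofReal (g z * Real.log (g z) + 1 - g z) ∂μ := by
    rw [KL, if_pos hac]
  have hφm : Measurable fun z => g z * Real.log (g z) + 1 - g z := by fun_prop
  have hφI : Integrable (fun z => g z * Real.log (g z) + 1 - g z) μ := by
    refine ⟨hφm.aestronglyMeasurable, ?_⟩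
    rw [hasFiniteIntegral_iff_ofReal (ae_of_all _ hφ0), ← hKL]
    exact lt_top_iff_ne_top.2 hρ
  have hKLr : (KL ρ μ).toReal = ∫ z, (g z * Real.log (g z) + 1 - g z) ∂μ := by
    rw [hKL, integral_eq_lintegral_of_nonneg_ae (ae_of_all _ hφ0) hφm.aestronglyMeasurable]
  have hIH : Integrable (fun z => (√(g z) - √(Real.exp (u z))) ^ 2) μ := by
    refine Integrable.mono' (hIg.add hIe) (by fun_prop) (ae_of_all _ fun z => ?_)
    rw [Real.norm_eq_abs, abs_of_nonneg (sq_nonneg _)]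
    have h1 := Real.sq_sqrt (hg0 z)
    have h2 := Real.sq_sqrt (Real.exp_pos (u z)).le
    have h3 := mul_nonneg (Real.sqrt_nonneg (g z)) (Real.sqrt_nonneg (Real.exp (u z)))
    simp only [Pi.add_apply]
    nlinarith
  have hIgu : Integrable (fun z => g z * u z) μ := by
    refine hIg.mul_bdd (c := C) hu.aestronglyMeasurable (ae_of_all _ fun z => hC z)
  set H := ∫ z, (√(g z) - √(Real.exp (u z))) ^ 2 ∂μ
  have hH : 0 ≤ H := integral_nonneg fun _ => sq_nonneg _
  refine ⟨2 * √H, ?_, ?_⟩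
  · intro φ hφ hφ1
    have hb : ∀ f : Ω2 → ℝ, Integrable f μ → Integrable (fun z => f z * φ z) μ := fun f hf =>
      hf.mul_bdd (c := 1) hφ.aestronglyMeasurable (ae_of_all _ hφ1)
    rw [hint, integral_withDensity_exp hu hν, ← integral_sub (hb _ hIg) (hb _ hIe)]
    refine le_two_sqrt_of_forall hH fun s hs => ?_
    have hIge : Integrable (fun z => g z + Real.exp (u z)) μ := hIg.add hIe
    have hIr : Integrable (fun z => (√(g z) - √(Real.exp (u z))) ^ 2 / (2 * s)
        + s * (g z + Real.exp (u z))) μ :=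
      (hIH.div_const _).add ((hIg.add hIe).const_mul s)
    calc |∫ z, (g z * φ z - Real.exp (u z) * φ z) ∂μ|
        ≤ ∫ z, ((√(g z) - √(Real.exp (u z))) ^ 2 / (2 * s) + s * (g z + Real.exp (u z))) ∂μ := by
          rw [← Real.norm_eq_abs]
          refine norm_integral_le_of_norm_le hIr (ae_of_all _ fun z => ?_)
          rw [← sub_mul, norm_mul, Real.norm_eq_abs, Real.norm_eq_abs]
          have h1 := Real.sq_sqrt (hg0 z)
          have h2 := Real.sq_sqrt (Real.exp_pos (u z)).le
          set a := √(g z)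
          set b := √(Real.exp (u z))
          rw [← h1, ← h2]
          have h3 : |a ^ 2 - b ^ 2| ≤ (a - b) ^ 2 / (2 * s) + s * (a ^ 2 + b ^ 2) := by
            have h4 : |a ^ 2 - b ^ 2| = |a - b| * |a + b| := by rw [← abs_mul]; ring_nf
            have h5 : (a - b) ^ 2 / (2 * s) + s * (a ^ 2 + b ^ 2) - |a - b| * |a + b| =
                ((|a - b| - s * |a + b|) ^ 2 + s ^ 2 * (a - b) ^ 2) / (2 * s) := by
              field_simp
              nlinarith [sq_abs (a - b), sq_abs (a + b)]
            have h6 : 0 ≤ ((|a - b| - s * |a + b|) ^ 2 + s ^ 2 * (a - b) ^ 2) / (2 * s) := by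
              positivity
            rw [h4]; linarith
          calc |a ^ 2 - b ^ 2| * |φ z| ≤ |a ^ 2 - b ^ 2| * 1 := by gcongr; exact hφ1 z
            _ ≤ _ := by rw [mul_one]; exact h3
      _ = H / (2 * s) + 2 * s := by
          rw [integral_add (hIH.div_const _) (hIge.const_mul s), integral_div,
            integral_const_mul, integral_add hIg hIe, hgone, hone]
          ring
  · rw [mul_pow, Real.sq_sqrt hH, hKLr, hint]
    have h1 : Integrable (fun z => (√(g z) - √(Real.exp (u z))) ^ 2 + g z * u z) μ := hIH.add hIgu
    have h2 : Integrable (fun z => (√(g z) - √(Real.exp (u z))) ^ 2 + g z * u z + 1) μ :=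
      h1.add (integrable_const 1)
    have : ∫ z, ((√(g z) - √(Real.exp (u z))) ^ 2 + g z * u z + 1 - Real.exp (u z)) ∂μ =
        H + ∫ z, g z * u z ∂μ := by
      rw [integral_sub h2 hIe, integral_add h1 (integrable_const 1), integral_add hIH hIgu, hone]
      simp [H]
    have hle := integral_mono (h2.sub hIe) hφI fun z => entropy_integrand_ge (hg0 z) (u z)
    have hle' : H + ∫ z, g z * u z ∂μ ≤ ∫ z, (g z * Real.log (g z) + 1 - g z) ∂μ :=
      this ▸ hle
    linarith

end Entropy

/-- `ν` is an exponential tilt of `μ` with log-density `u` solving the mean-field equation. -/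
structure IsGibbs {k : ℕ} (σ : Equiv.Perm (Fin (k + 1))) (μ : Measure Ω2) (θ : ℝ)
    (ν : Measure Ω2) (u : Ω2 → ℝ) : Prop where
  prob : IsProbabilityMeasure ν
  dens : ν = μ.withDensity fun z => ENNReal.ofReal (Real.exp (u z))
  pot : ∃ c, ∀ z, u z = θ * (k + 1) * hCond σ ν z - c

section Gibbs

variable {k : ℕ} {σ : Equiv.Perm (Fin (k + 1))} {μ ν : Measure Ω2} {θ : ℝ} {u : Ω2 → ℝ}

lemma exists_isGibbs (σ : Equiv.Perm (Fin (k + 1))) (μ : Measure Ω2) [IsProbabilityMeasure μ]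
    (hθ : |θ| * (k + 1) ^ 2 ≤ 1 / 100) : ∃ ν u, IsGibbs σ μ θ ν u := by
  obtain ⟨ν, hν, h⟩ := exists_tilted_fixedPoint σ μ hθ
  refine ⟨ν, fun z => θ * (k + 1) * hCond σ ν z
    - Real.log (∫ z, Real.exp (θ * (k + 1) * hCond σ ν z) ∂μ), hν, ?_, _, fun z => rfl⟩
  have hpos : 0 < ∫ z, Real.exp (θ * (k + 1) * hCond σ ν z) ∂μ := by
    refine integral_exp_pos (integrable_exp_of_abs_le ((measurable_hCond σ ν).const_mul _)
      (C := |θ * (k + 1)|) fun z => ?_)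
    rw [abs_mul]; exact mul_le_of_le_one_right (abs_nonneg _) (hCond_abs_le σ ν z)
  conv_lhs => rw [h]
  simp only [Measure.tilted, Real.exp_sub, Real.exp_log hpos]

namespace IsGibbs

lemma measurable (h : IsGibbs σ μ θ ν u) : Measurable u := by
  have := h.prob
  obtain ⟨c, hc⟩ := h.pot
  rw [funext hc]
  exact ((measurable_hCond σ ν).const_mul _).sub_const c

lemma bounded (h : IsGibbs σ μ θ ν u) : ∃ C, ∀ z, |u z| ≤ C := by
  have := h.prob
  obtain ⟨c, hc⟩ := h.pot
  refine ⟨|θ * (k + 1)| + |c|, fun z => ?_⟩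
  rw [hc]
  refine (abs_sub _ _).trans ?_
  rw [abs_mul]
  gcongr
  exact mul_le_of_le_one_right (abs_nonneg _) (hCond_abs_le σ ν z)

lemma absolutelyContinuous (h : IsGibbs σ μ θ ν u) : ν ≪ μ :=
  h.dens ▸ withDensity_absolutelyContinuous _ _

lemma KL_eq [IsProbabilityMeasure μ] (h : IsGibbs σ μ θ ν u) :
    KL ν μ = ENNReal.ofReal (∫ z, u z ∂ν) ∧ 0 ≤ ∫ z, u z ∂ν := by
  have := h.prob
  obtain ⟨C, hC⟩ := h.bounded
  exact KL_withDensity_exp h.measurable hC h.dens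

lemma integral_eq (h : IsGibbs σ μ θ ν u) {c : ℝ} (hc : ∀ z, u z = θ * (k + 1) * hCond σ ν z - c)
    (ρ : Measure Ω2) [IsProbabilityMeasure ρ] :
    ∫ z, u z ∂ρ = θ * (k + 1) * ∫ z, hCond σ ν z ∂ρ - c := by
  have := h.prob
  have hI : Integrable (hCond σ ν) ρ := integrable_of_abs_le (measurable_hCond σ ν)
    (hCond_abs_le σ ν)
  simp_rw [hc]
  rw [integral_sub (hI.const_mul _) (integrable_const c), integral_const_mul]
  simp

/-- Quantitative optimality of the mean-field solution. -/
lemma exists_tvBound [IsProbabilityMeasure μ] (h : IsGibbs σ μ θ ν u)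
    (hθ : |θ| * (k + 1) ^ 2 ≤ 1 / 100)
    (ρ : Measure Ω2) [IsProbabilityMeasure ρ] (hρ : KL ρ μ ≠ ∞) :
    ∃ r, TVBound ν ρ r ∧
      θ * tPat σ ρ - (KL ρ μ).toReal + r ^ 2 / 8 ≤ θ * tPat σ ν - (KL ν μ).toReal := by
  have := h.prob
  obtain ⟨C, hC⟩ := h.bounded
  obtain ⟨c, hc⟩ := h.pot
  obtain ⟨r, htv, hr⟩ := exists_tvBound_of_KL h.measurable hC h.dens hρ
  refine ⟨r, htv, ?_⟩
  have hrem := htv.abs_tRem_le σ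
  rw [h.KL_eq.1, ENNReal.toReal_ofReal h.KL_eq.2]
  rw [h.integral_eq hc] at hr ⊢
  rw [← tPat_eq_integral_hCond]
  have h1 : θ * tRem σ ν ρ ≤ r ^ 2 / 100 := by
    calc θ * tRem σ ν ρ ≤ |θ| * |tRem σ ν ρ| := by rw [← abs_mul]; exact le_abs_self _
      _ ≤ |θ| * ((k + 1) ^ 2 * r ^ 2) := by gcongr
      _ = (|θ| * (k + 1) ^ 2) * r ^ 2 := by ring
      _ ≤ 1 / 100 * r ^ 2 := by gcongr
      _ = r ^ 2 / 100 := by ring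
  unfold tRem at h1
  nlinarith [sq_nonneg r]

end IsGibbs

end Gibbs

/-! ### The variational problem -/

lemma mem_Mcal_of_absolutelyContinuous {μ ν : ProbabilityMeasure Ω2} (hμ : μ ∈ Mcal)
    (h : (ν : Measure Ω2) ≪ μ) : ν ∈ Mcal := by
  obtain ⟨h0, h1, h2⟩ := hμ
  refine ⟨?_, fun x => ?_, fun y => ?_⟩
  · have hm : MeasurableSet unitSq := measurableSet_Icc.prod measurableSet_Icc
    have h0' : (μ : Measure Ω2) unitSqᶜ = 0 := (prob_compl_eq_zero_iff hm).2 h0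
    exact (prob_compl_eq_zero_iff hm).1 (h h0')
  · exact (h.map measurable_fst) (h1 x)
  · exact (h.map measurable_snd) (h2 y)

lemma KL_self (μ : Measure Ω2) [IsProbabilityMeasure μ] : KL μ μ = 0 := by
  have := (KL_withDensity_exp (μ := μ) (ν := μ) (u := fun _ => 0) measurable_const (C := 0)
    (by simp) (by simp)).1
  simpa using this

namespace IsGibbs

variable {k : ℕ} {σ : Equiv.Perm (Fin (k + 1))} {μ ν : Measure Ω2} {θ : ℝ} {u : Ω2 → ℝ}

lemma sq_le [IsProbabilityMeasure μ] (h : IsGibbs σ μ θ ν u)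
    (hθ : |θ| * (k + 1) ^ 2 ≤ 1 / 100) (ρ : Measure Ω2) [IsProbabilityMeasure ρ]
    (hρ : KL ρ μ ≠ ∞) :
    θ * tPat σ ρ - (KL ρ μ).toReal + (tPat σ ρ - tPat σ ν) ^ 2 / (8 * (k + 1) ^ 2) ≤
      θ * tPat σ ν - (KL ν μ).toReal := by
  have := h.prob
  obtain ⟨r, htv, hr⟩ := h.exists_tvBound hθ ρ hρ
  have h1 := htv.tPat_sub_le σ
  have hk : (0 : ℝ) < (k + 1) := by positivity
  have h2 : (tPat σ ρ - tPat σ ν) ^ 2 ≤ ((k + 1) * r) ^ 2 := by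
    rw [← sq_abs]
    push_cast at h1
    gcongr
  have h3 : (tPat σ ρ - tPat σ ν) ^ 2 / (8 * (k + 1) ^ 2) ≤ r ^ 2 / 8 := by
    rw [div_le_div_iff₀ (by positivity) (by norm_num)]
    nlinarith
  linarith

lemma eq_of_le [IsProbabilityMeasure μ] (h : IsGibbs σ μ θ ν u)
    (hθ : |θ| * (k + 1) ^ 2 ≤ 1 / 100) (ρ : Measure Ω2) [IsProbabilityMeasure ρ]
    (hρ : KL ρ μ ≠ ∞)
    (hle : θ * tPat σ ν - (KL ν μ).toReal ≤ θ * tPat σ ρ - (KL ρ μ).toReal) : ρ = ν := by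
  have := h.prob
  obtain ⟨r, htv, hr⟩ := h.exists_tvBound hθ ρ hρ
  have h0 : r = 0 := by nlinarith [sq_nonneg r]
  subst h0
  exact htv.eq_of_zero

lemma KL_ne_top [IsProbabilityMeasure μ] (h : IsGibbs σ μ θ ν u) : KL ν μ ≠ ∞ := by
  rw [h.KL_eq.1]; exact ENNReal.ofReal_ne_top

lemma tPat_eq_of_zero [IsProbabilityMeasure μ] (h : IsGibbs σ μ 0 ν u) : tPat σ ν = tPat σ μ := by
  have := h.eq_of_le (by simp) μ (by simp [KL_self]) (by simp [KL_self])
  rw [this]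

lemma isCC_of_eq [IsProbabilityMeasure μ] (h : IsGibbs σ μ θ μ u) (hθ : θ ≠ 0) : IsCC σ μ := by
  obtain ⟨c, hc⟩ := h.pot
  have h1 : (fun _ => 1) =ᵐ[μ] fun z => ENNReal.ofReal (Real.exp (u z)) := by
    have h2 : (μ.withDensity fun z => ENNReal.ofReal (Real.exp (u z))).rnDeriv μ =ᵐ[μ] _ :=
      Measure.rnDeriv_withDensity μ (by have := h.measurable; fun_prop)
    rw [← h.dens] at h2
    exact (Measure.rnDeriv_self μ).symm.trans h2
  have h3 : ∀ᵐ z ∂μ, hCond σ μ z = c / (θ * (k + 1)) := by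
    filter_upwards [h1] with z hz
    have h4 : u z = 0 := by
      have : Real.exp (u z) = 1 := by
        have := congrArg ENNReal.toReal hz
        rw [ENNReal.toReal_ofReal (Real.exp_pos _).le] at this
        simpa using this.symm
      simpa using this
    have hk : (k + 1 : ℝ) ≠ 0 := by positivity
    rw [hc] at h4
    rw [eq_div_iff (mul_ne_zero hθ hk)]
    linarith
  obtain ⟨z, hz⟩ := h3.exists
  exact ⟨c / (θ * (k + 1)), ⟨hz ▸ hCond_nonneg σ μ z, hz ▸ hCond_le_one σ μ z⟩, h3⟩

lemma tPat_lt [IsProbabilityMeasure μ] (h : IsGibbs σ μ θ ν u)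
    (hθ : |θ| * (k + 1) ^ 2 ≤ 1 / 100) (h0 : 0 < θ) (hcc : ¬ IsCC σ μ) :
    tPat σ μ < tPat σ ν := by
  by_contra! hle
  have h1 := h.eq_of_le hθ μ (by simp [KL_self]) (by
    have : 0 ≤ (KL ν μ).toReal := ENNReal.toReal_nonneg
    rw [KL_self]
    simp only [ENNReal.toReal_zero]
    nlinarith)
  subst h1
  exact hcc (h.isCC_of_eq h0.ne')

end IsGibbs

lemma Fset_eq_singleton {k : ℕ} {σ : Equiv.Perm (Fin (k + 1))} {μ ν : ProbabilityMeasure Ω2}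
    (hμ : μ ∈ Mcal) {θ : ℝ} {u : Ω2 → ℝ} (h : IsGibbs σ (μ : Measure Ω2) θ (ν : Measure Ω2) u)
    (hθ : |θ| * (k + 1) ^ 2 ≤ 1 / 100) : Fset σ (μ : Measure Ω2) θ = {ν} := by
  have hν : ν ∈ Mcal := mem_Mcal_of_absolutelyContinuous hμ h.absolutelyContinuous
  have key : ∀ (ρ : ProbabilityMeasure Ω2), KL ρ μ ≠ ∞ →
      (((θ * tPat σ (ρ : Measure Ω2) : ℝ) : EReal) - ((KL (↑ρ) μ : ℝ≥0∞) : EReal)) =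
        ((θ * tPat σ (ρ : Measure Ω2) - (KL (↑ρ) μ).toReal : ℝ) : EReal) := by
    intro ρ hρ
    rw [EReal.coe_sub, EReal.coe_ennreal_toReal hρ]
  have hbot : ∀ (ρ : ProbabilityMeasure Ω2), KL ρ μ = ∞ →
      (((θ * tPat σ (ρ : Measure Ω2) : ℝ) : EReal) - ((KL (↑ρ) μ : ℝ≥0∞) : EReal)) = ⊥ := by
    intro ρ hρ
    rw [hρ]; simp
  have hsup : Fsup σ (μ : Measure Ω2) θ =
      ((θ * tPat σ (ν : Measure Ω2) - (KL (↑ν) μ).toReal : ℝ) : EReal) := by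
    refine le_antisymm (iSup₂_le fun ρ _ => ?_) ?_
    · by_cases hρ : KL ρ μ = ∞
      · rw [hbot ρ hρ]; exact bot_le
      · rw [key ρ hρ]
        have h1 := h.sq_le hθ ρ hρ
        have h2 : 0 ≤ (tPat σ (ρ : Measure Ω2) - tPat σ (ν : Measure Ω2)) ^ 2
          / (8 * ((k : ℝ) + 1) ^ 2) := by positivity
        exact_mod_cast (by linarith)
    · rw [← key ν h.KL_ne_top]
      exact le_iSup₂ (f := fun (ρ : ProbabilityMeasure Ω2) (_ : ρ ∈ Mcal) =>
        (((θ * tPat σ (ρ : Measure Ω2) : ℝ) : EReal) - ((KL (↑ρ) μ : ℝ≥0∞) : EReal))) ν hν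
  ext ρ
  simp only [Fset, Set.mem_ofPred_eq, Set.mem_singleton_iff, hsup]
  constructor
  · rintro ⟨-, hρ⟩
    have hne : KL ρ μ ≠ ∞ := fun hρ' => by
      rw [hbot ρ hρ'] at hρ; exact EReal.bot_ne_coe _ hρ
    rw [key ρ hne, EReal.coe_eq_coe_iff] at hρ
    exact Subtype.ext (h.eq_of_le hθ ρ hne hρ.ge)
  · rintro rfl
    exact ⟨hν, key ρ h.KL_ne_top⟩

/-- If `ν` is a Gibbs measure at `θ > 0` then it is the unique minimizer at `δ = t_σ(ν)`. -/
lemma Gset_eq_singleton {k : ℕ} {σ : Equiv.Perm (Fin (k + 1))} {μ ν : ProbabilityMeasure Ω2}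
    (hμ : μ ∈ Mcal) {θ : ℝ} {u : Ω2 → ℝ} (h : IsGibbs σ (μ : Measure Ω2) θ (ν : Measure Ω2) u)
    (hθ : |θ| * (k + 1) ^ 2 ≤ 1 / 100) (h0 : 0 < θ) :
    Gfun σ (μ : Measure Ω2) (tPat σ (ν : Measure Ω2)) = KL (ν : Measure Ω2) μ ∧
      Gset σ (μ : Measure Ω2) (tPat σ (ν : Measure Ω2)) = {ν} := by
  have hν : ν ∈ Mcal := mem_Mcal_of_absolutelyContinuous hμ h.absolutelyContinuous
  have hG : Gfun σ (μ : Measure Ω2) (tPat σ (ν : Measure Ω2)) = KL (ν : Measure Ω2) μ := by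
    refine le_antisymm (iInf₂_le ν ⟨hν, le_rfl⟩) (le_iInf₂ fun ρ hρ => ?_)
    by_cases hT : KL ρ μ = ∞
    · rw [hT]; exact le_top
    · have h1 := h.sq_le hθ ρ hT
      have h2 : 0 ≤ (tPat σ (ρ : Measure Ω2) - tPat σ (ν : Measure Ω2)) ^ 2
          / (8 * ((k : ℝ) + 1) ^ 2) := by positivity
      rw [← ENNReal.toReal_le_toReal h.KL_ne_top hT]
      have h3 := mul_le_mul_of_nonneg_left hρ.2 h0.le
      linarith
  refine ⟨hG, ?_⟩
  ext ρ
  simp only [Gset, Set.mem_ofPred_eq, Set.mem_singleton_iff, hG]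
  constructor
  · rintro ⟨⟨-, hρ⟩, hK⟩
    refine Subtype.ext (h.eq_of_le hθ ρ (hK ▸ h.KL_ne_top) ?_)
    rw [hK]
    have h3 := mul_le_mul_of_nonneg_left hρ h0.le
    linarith
  · rintro rfl
    exact ⟨⟨hν, le_rfl⟩, rfl⟩

lemma le_Gfun_toReal {k : ℕ} {σ : Equiv.Perm (Fin (k + 1))} {μ ν : ProbabilityMeasure Ω2}
    {θ : ℝ} {u : Ω2 → ℝ} (h : IsGibbs σ (μ : Measure Ω2) θ (ν : Measure Ω2) u)
    (hθ : |θ| * (k + 1) ^ 2 ≤ 1 / 100) {ρ : ProbabilityMeasure Ω2} (hρ : KL ρ μ ≠ ∞) :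
    (KL ν μ).toReal - θ * (tPat σ (ν : Measure Ω2) - tPat σ (ρ : Measure Ω2)) ≤
      (KL ρ μ).toReal := by
  have h1 := h.sq_le hθ ρ hρ
  have h2 : 0 ≤ (tPat σ (ρ : Measure Ω2) - tPat σ (ν : Measure Ω2)) ^ 2
          / (8 * ((k : ℝ) + 1) ^ 2) := by positivity
  linarith

section RealAnalysis

variable {t D : ℝ → ℝ} {c B : ℝ}

lemma mul_sub_ge_of_variational (h : ∀ θ ∈ Set.Ioo (-B) B, ∀ θ' ∈ Set.Ioo (-B) B,
      θ * t θ' - D θ' + c * (t θ' - t θ) ^ 2 ≤ θ * t θ - D θ)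
    {θ θ' : ℝ} (h1 : θ ∈ Set.Ioo (-B) B) (h2 : θ' ∈ Set.Ioo (-B) B) :
    2 * c * (t θ - t θ') ^ 2 ≤ (θ - θ') * (t θ - t θ') := by
  have a := h θ h1 θ' h2
  have b := h θ' h2 θ h1
  nlinarith

lemma monotoneOn_of_variational (hc : 0 < c) (h : ∀ θ ∈ Set.Ioo (-B) B, ∀ θ' ∈ Set.Ioo (-B) B,
      θ * t θ' - D θ' + c * (t θ' - t θ) ^ 2 ≤ θ * t θ - D θ) :
    MonotoneOn t (Set.Ioo (-B) B) := by
  intro a ha b hb hab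
  by_contra! hlt
  have := mul_sub_ge_of_variational h ha hb
  nlinarith [mul_pos hc (pow_pos (sub_pos.2 hlt) 2), mul_nonneg (sub_nonneg.2 hab)
    (sub_nonneg.2 hlt.le)]

lemma abs_sub_le_of_variational (hc : 0 < c)
    (h : ∀ θ ∈ Set.Ioo (-B) B, ∀ θ' ∈ Set.Ioo (-B) B,
      θ * t θ' - D θ' + c * (t θ' - t θ) ^ 2 ≤ θ * t θ - D θ)
    {θ θ' : ℝ} (h1 : θ ∈ Set.Ioo (-B) B) (h2 : θ' ∈ Set.Ioo (-B) B) :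
    |t θ - t θ'| ≤ 1 / (2 * c) * |θ - θ'| := by
  have a := mul_sub_ge_of_variational h h1 h2
  rw [one_div, inv_mul_eq_div, le_div_iff₀ (by positivity)]
  have b : (θ - θ') * (t θ - t θ') ≤ |θ - θ'| * |t θ - t θ'| := by
    rw [← abs_mul]; exact le_abs_self _
  rw [← sq_abs] at a
  rcases (abs_nonneg (t θ - t θ')).eq_or_lt with h0 | h0
  · rw [← h0]; simp
  · have : |t θ - t θ'| * (|t θ - t θ'| * (2 * c)) ≤ |t θ - t θ'| * |θ - θ'| := by nlinarith
    exact le_of_mul_le_mul_left this h0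

lemma continuousOn_of_variational (hc : 0 < c)
    (h : ∀ θ ∈ Set.Ioo (-B) B, ∀ θ' ∈ Set.Ioo (-B) B,
      θ * t θ' - D θ' + c * (t θ' - t θ) ^ 2 ≤ θ * t θ - D θ) :
    ContinuousOn t (Set.Ioo (-B) B) := by
  refine LipschitzOnWith.continuousOn (K := Real.toNNReal (1 / (2 * c)))
    (LipschitzOnWith.of_dist_le_mul fun x hx y hy => ?_)
  rw [Real.coe_toNNReal _ (by positivity), Real.dist_eq, Real.dist_eq]
  exact abs_sub_le_of_variational hc h hx hy

lemma entropy_sub_le_of_variational (hc : 0 < c)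
    (h : ∀ θ ∈ Set.Ioo (-B) B, ∀ θ' ∈ Set.Ioo (-B) B,
      θ * t θ' - D θ' + c * (t θ' - t θ) ^ 2 ≤ θ * t θ - D θ)
    {θ θ' : ℝ} (h1 : θ ∈ Set.Ioo (-B) B) (h2 : θ' ∈ Set.Ioo (-B) B) :
    D θ - D θ' ≤ B * (1 / (2 * c) * |θ - θ'|) := by
  have a := h θ h1 θ' h2
  have b := abs_sub_le_of_variational hc h h1 h2
  have d : θ * (t θ - t θ') ≤ B * |t θ - t θ'| := by
    refine (le_abs_self _).trans ?_
    rw [abs_mul]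
    gcongr
    exact (abs_lt.2 h1).le
  have hB : 0 < B := by linarith [h1.1, h1.2]
  have e : B * |t θ - t θ'| ≤ B * (1 / (2 * c) * |θ - θ'|) := by gcongr
  nlinarith [mul_nonneg hc.le (sq_nonneg (t θ' - t θ))]

lemma exists_isGreatest_of_variational (hc : 0 < c)
    (h : ∀ θ ∈ Set.Ioo (-B) B, ∀ θ' ∈ Set.Ioo (-B) B,
      θ * t θ' - D θ' + c * (t θ' - t θ) ^ 2 ≤ θ * t θ - D θ) (hB : 0 < B)
    {δ : ℝ} (hδ : δ ∈ Set.Ioo (t 0) (sSup (t '' Set.Ioo (-B) B))) :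
    ∃ a, IsGreatest {θ | θ ∈ Set.Ioo 0 B ∧ t θ = δ} a ∧ ∀ θ ∈ Set.Ioo a B, δ < t θ := by
  have hz : (0 : ℝ) ∈ Set.Ioo (-B) B := ⟨by linarith, hB⟩
  have hmono := monotoneOn_of_variational hc h
  have hcont := continuousOn_of_variational hc h
  obtain ⟨_, ⟨b, hb, rfl⟩, hbδ⟩ := exists_lt_of_lt_csSup (Set.Nonempty.image _ ⟨0, hz⟩) hδ.2
  have hb0 : 0 < b := by
    by_contra! hle
    have := hmono hb hz hle
    linarith [hδ.1]
  have hsub : Set.Icc 0 b ⊆ Set.Ioo (-B) B := fun x hx => ⟨by linarith [hx.1], hx.2.trans_lt hb.2⟩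
  have hcont' : ContinuousOn t (Set.Icc 0 b) := hcont.mono hsub
  obtain ⟨x, hx, hxδ⟩ := intermediate_value_Icc hb0.le hcont' ⟨hδ.1.le, hbδ.le⟩
  have hK : IsCompact (Set.Icc 0 b ∩ t ⁻¹' {δ}) :=
    isCompact_Icc.of_isClosed_subset (hcont'.preimage_isClosed_of_isClosed isClosed_Icc
      isClosed_singleton) Set.inter_subset_left
  obtain ⟨a, ⟨ha, haδ⟩, hamax⟩ := hK.exists_isGreatest ⟨x, hx, hxδ⟩
  have ha0 : 0 < a := by
    rcases ha.1.eq_or_lt with h0 | h0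
    · rw [← h0] at haδ
      exact absurd haδ hδ.1.ne
    · exact h0
  have hmax : ∀ θ ∈ Set.Ioo 0 B, t θ = δ → θ ≤ a := by
    intro θ hθ hθδ
    refine hamax ⟨⟨hθ.1.le, ?_⟩, hθδ⟩
    by_contra! hlt
    have := hmono hb ⟨by linarith [hθ.1], hθ.2⟩ hlt.le
    linarith
  refine ⟨a, ⟨⟨⟨ha0, ha.2.trans_lt hb.2⟩, haδ⟩, fun θ hθ => hmax θ hθ.1 hθ.2⟩, fun θ hθ => ?_⟩
  have h0 : θ ∈ Set.Ioo 0 B := ⟨ha0.trans hθ.1, hθ.2⟩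
  have h1 : δ ≤ t θ := by
    rw [← (show t a = δ from haδ)]
    exact hmono (hsub ha) ⟨by linarith [h0.1], h0.2⟩ hθ.1.le
  refine lt_of_le_of_ne h1 fun h2 => ?_
  exact absurd (hmax θ h0 h2.symm) (not_le.2 hθ.1)

end RealAnalysis

/-! ### Product measures and empirical measures -/

section Product

variable {E : Type*} [MeasurableSpace E]

lemma lintegral_pi_prod (ν : Measure E) [IsProbabilityMeasure ν] (n : ℕ) (f : Fin n → E → ℝ≥0∞)
    (hf : ∀ i, Measurable (f i)) :
    ∫⁻ z, ∏ i, f i (z i) ∂Measure.pi (fun _ : Fin n => ν) = ∏ i, ∫⁻ x, f i x ∂ν := by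
  induction n with
  | zero => simp
  | succ n ih =>
    have hmp := measurePreserving_piFinSuccAbove (fun _ : Fin (n + 1) => ν) 0
    have hm : Measurable fun w : Fin n → E => ∏ i : Fin n, f i.succ (w i) :=
      Finset.measurable_prod _ fun i _ => (hf _).comp (measurable_pi_apply i)
    rw [← hmp.symm.lintegral_comp_emb (MeasurableEquiv.measurableEmbedding _), Fin.prod_univ_succ,
      ← ih (fun i => f i.succ) (fun i => hf _), ← lintegral_prod_mul (hf 0).aemeasurable
        hm.aemeasurable]
    refine lintegral_congr fun p => ?_
    simp [Fin.prod_univ_succ, MeasurableEquiv.piFinSuccAbove]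

lemma pi_withDensity (μ ν : Measure E) [IsProbabilityMeasure μ] [IsProbabilityMeasure ν]
    {h : E → ℝ≥0∞} (hh : Measurable h) (hν : ν = μ.withDensity h) (n : ℕ) :
    Measure.pi (fun _ : Fin n => ν) =
      (Measure.pi (fun _ : Fin n => μ)).withDensity fun z => ∏ i, h (z i) := by
  refine Measure.pi_eq fun s hs => ?_
  rw [withDensity_apply _ (MeasurableSet.univ_pi hs),
    ← lintegral_indicator (MeasurableSet.univ_pi hs)]
  have : ∀ z : Fin n → E, (Set.univ.pi s).indicator (fun z => ∏ i, h (z i)) z =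
      ∏ i, (s i).indicator h (z i) := by
    intro z
    by_cases hz : z ∈ Set.univ.pi s
    · rw [Set.indicator_of_mem hz]
      exact Finset.prod_congr rfl fun i _ => (Set.indicator_of_mem (hz i trivial) _).symm
    · rw [Set.indicator_of_notMem hz]
      simp only [Set.mem_pi, Set.mem_univ, true_implies, not_forall] at hz
      obtain ⟨i, hi⟩ := hz
      exact (Finset.prod_eq_zero (Finset.mem_univ i) (Set.indicator_of_notMem hi _)).symm
  simp_rw [this]
  rw [lintegral_pi_prod μ n _ fun i => hh.indicator (hs i)]
  refine Finset.prod_congr rfl fun i _ => ?_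
  rw [lintegral_indicator (hs i), hν, withDensity_apply _ (hs i)]

/-- The empirical measure of `n` points. -/
def emp {n : ℕ} (z : Fin n → E) : Measure E := (n : ℝ≥0∞)⁻¹ • ∑ i, Measure.dirac (z i)

lemma isProbabilityMeasure_emp {n : ℕ} (hn : n ≠ 0) (z : Fin n → E) :
    IsProbabilityMeasure (emp z) := by
  constructor
  simp only [emp, Measure.smul_apply, Measure.finsetSum_apply, measure_univ, Finset.sum_const,
    Finset.card_univ, Fintype.card_fin, nsmul_eq_mul, mul_one, smul_eq_mul]
  exact ENNReal.inv_mul_cancel (by exact_mod_cast hn) (ENNReal.natCast_ne_top n)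

lemma integral_emp [MeasurableSingletonClass E] {n : ℕ} (z : Fin n → E) (f : E → ℝ) :
    ∫ x, f x ∂emp z = (n : ℝ)⁻¹ * ∑ i, f (z i) := by
  rw [emp, integral_smul_measure, integral_finsetSum_measure fun i _ => integrable_dirac (by simp)]
  simp [integral_dirac]

lemma emp_real [MeasurableSingletonClass E] {n : ℕ} (z : Fin n → E) {S : Set E}
    (hS : MeasurableSet S) :
    (emp z).real S = (n : ℝ)⁻¹ * ∑ i, S.indicator (fun _ => (1 : ℝ)) (z i) := by
  rw [← integral_emp, integral_indicator_const _ hS]; simp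

lemma emp_map {F : Type*} [MeasurableSpace F] {n : ℕ} (z : Fin n → E) {g : E → F}
    (hg : Measurable g) : (emp z).map g = emp (g ∘ z) := by
  rw [emp, emp, Measure.map_smul, ← Measure.mapₗ_apply_of_measurable hg, map_sum]
  simp [Measure.mapₗ_apply_of_measurable hg, Measure.map_dirac' hg]

end Product

/-! ### Exponential moments -/

section Moments

variable {E : Type*} [MeasurableSpace E] {ν : Measure E} [IsProbabilityMeasure ν]

lemma lintegral_ofReal_exp_sum {g : E → ℝ} (hg : Measurable g) (n : ℕ) :
    ∫⁻ z, ENNReal.ofReal (Real.exp (∑ i, g (z i))) ∂Measure.pi (fun _ : Fin n => ν) =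
      (∫⁻ x, ENNReal.ofReal (Real.exp (g x)) ∂ν) ^ n := by
  have : ∀ z : Fin n → E, ENNReal.ofReal (Real.exp (∑ i, g (z i))) =
      ∏ i, ENNReal.ofReal (Real.exp (g (z i))) := fun z => by
    rw [Real.exp_sum, ENNReal.ofReal_prod_of_nonneg fun i _ => (Real.exp_pos _).le]
  simp_rw [this]
  rw [lintegral_pi_prod ν n (fun _ x => ENNReal.ofReal (Real.exp (g x))) fun _ => by fun_prop]
  simp

lemma lintegral_exp_centered_le {g : E → ℝ} (hg : Measurable g) (hg2 : ∀ x, |g x| ≤ 2)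
    (h0 : ∫ x, g x ∂ν = 0) {a : ℝ} (ha : |a| ≤ 2) :
    ∫⁻ x, ENNReal.ofReal (Real.exp (a / 8 * g x)) ∂ν ≤ ENNReal.ofReal (Real.exp (a ^ 2 / 16)) := by
  have hx : ∀ x, |a / 8 * g x| ≤ 1 := fun x => by
    rw [abs_mul, abs_div, abs_of_pos (by norm_num : (0 : ℝ) < 8)]
    nlinarith [hg2 x, abs_nonneg (g x), abs_nonneg a]
  have hI := integrable_exp_of_abs_le (μ := ν) (hg.const_mul (a / 8)) hx
  rw [← ofReal_integral_eq_lintegral_ofReal hI (ae_of_all _ fun x => (Real.exp_pos _).le)]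
  refine ENNReal.ofReal_le_ofReal ?_
  have hIg : Integrable g ν := integrable_of_abs_le hg hg2
  have hI2 : Integrable (fun x => (1 + a ^ 2 / 16) + a / 8 * g x) ν :=
    (integrable_const _).add (hIg.const_mul _)
  calc ∫ x, Real.exp (a / 8 * g x) ∂ν ≤ ∫ x, ((1 + a ^ 2 / 16) + a / 8 * g x) ∂ν := by
        refine integral_mono hI hI2 fun x => ?_
        have h1 := (abs_le.1 (Real.abs_exp_sub_one_sub_id_le (hx x))).2
        have h2 : g x ^ 2 ≤ 4 := by
          have := abs_le.1 (hg2 x)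
          nlinarith
        have h3 : (a / 8 * g x) ^ 2 ≤ a ^ 2 / 16 := by nlinarith [sq_nonneg a]
        simp only
        linarith
    _ = a ^ 2 / 16 + 1 := by
        rw [integral_add (integrable_const _) (hIg.const_mul _), integral_const_mul, h0]
        simp; ring
    _ ≤ _ := Real.add_one_le_exp _

lemma lintegral_exp_sq_le [MeasurableSingletonClass E] {f : E → ℝ} (hf : Measurable f)
    (hf1 : ∀ x, |f x| ≤ 1) {J : ℕ} (hJ : J ≠ 0) {n : ℕ} (hn : n ≠ 0) :
    ∫⁻ z, ENNReal.ofReal (Real.exp (n * ((∫ x, f x ∂emp z - ∫ x, f x ∂ν) ^ 2 / 16)))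
      ∂Measure.pi (fun _ : Fin n => ν) ≤
      (4 * J + 1 : ℕ) * ENNReal.ofReal (Real.exp (n * (1 / (16 * J ^ 2)))) := by
  set g : E → ℝ := fun x => f x - ∫ x, f x ∂ν with hgdef
  have hg : Measurable g := hf.sub_const _
  have hIf : Integrable f ν := integrable_of_abs_le hf hf1
  have hg2 : ∀ x, |g x| ≤ 2 := fun x => (abs_sub _ _).trans (by
    linarith [hf1 x, abs_integral_le_of_abs_le (m := ν) hf1])
  have hg0 : ∫ x, g x ∂ν = 0 := by
    rw [hgdef, integral_sub hIf (integrable_const _)]; simp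
  have hn' : (0 : ℝ) < n := by positivity
  have hJ' : (0 : ℝ) < J := by positivity
  have hX : ∀ z : Fin n → E, n * (∫ x, f x ∂emp z - ∫ x, f x ∂ν) = ∑ i, g (z i) := fun z => by
    rw [integral_emp, hgdef, Finset.sum_sub_distrib]
    simp; field_simp
  have hX2 : ∀ z : Fin n → E, |∫ x, f x ∂emp z - ∫ x, f x ∂ν| ≤ 2 := fun z => by
    have := isProbabilityMeasure_emp hn z
    refine (abs_sub _ _).trans ?_
    linarith [abs_integral_le_of_abs_le (m := ν) hf1, abs_integral_le_of_abs_le (m := emp z) hf1]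
  set S : Finset ℤ := Finset.Icc (-(2 * J : ℤ)) (2 * J)
  have hcard : S.card = 4 * J + 1 := by
    simp only [S, Int.card_Icc]; omega
  let T : ℤ → (Fin n → E) → ℝ≥0∞ := fun j z =>
    ENNReal.ofReal (Real.exp (n * (1 / (16 * J ^ 2) - ((j : ℝ) / J) ^ 2 / 16))) *
      ENNReal.ofReal (Real.exp (∑ i, ((j : ℝ) / J) / 8 * g (z i)))
  have hTm : ∀ j : ℤ, Measurable fun z : Fin n → E =>
      ENNReal.ofReal (Real.exp (∑ i, ((j : ℝ) / J) / 8 * g (z i))) := fun j => by fun_prop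
  have hpt : ∀ z : Fin n → E, ENNReal.ofReal (Real.exp
      (n * ((∫ x, f x ∂emp z - ∫ x, f x ∂ν) ^ 2 / 16))) ≤ ∑ j ∈ S, T j z := by
    intro z
    set X := ∫ x, f x ∂emp z - ∫ x, f x ∂ν with hXdef
    have h2 := abs_le.1 (hX2 z)
    have hjS : ⌊J * X⌋ ∈ S := by
      simp only [S, Finset.mem_Icc]
      constructor
      · rw [Int.le_floor]; push_cast; nlinarith
      · have : ⌊J * X⌋ ≤ ⌊(2 * J : ℝ)⌋ := Int.floor_le_floor (by nlinarith)
        refine this.trans (le_of_eq ?_)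
        have : (2 * J : ℝ) = ((2 * J : ℤ) : ℝ) := by push_cast; ring
        rw [this, Int.floor_intCast]
    refine le_trans ?_ (Finset.single_le_sum (f := fun j => T j z) (fun _ _ => zero_le) hjS)
    simp only [T]
    rw [← ENNReal.ofReal_mul (Real.exp_pos _).le, ← Real.exp_add, ← Finset.mul_sum, ← hX, ← hXdef]
    refine ENNReal.ofReal_le_ofReal (Real.exp_le_exp.2 ?_)
    set j := ⌊J * X⌋
    set a : ℝ := (j : ℝ) / J with ha
    have h3 : (X - a) ^ 2 ≤ 1 / J ^ 2 := by
      have h4 := Int.floor_le (J * X)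
      have h5 := Int.lt_floor_add_one (J * X)
      have h6 : X - a = (J * X - j) / J := by rw [ha]; field_simp
      rw [h6, div_pow]
      gcongr
      have h7 : 0 ≤ J * X - j := by linarith
      have h8 : J * X - j ≤ 1 := by linarith
      nlinarith
    have h9 : X ^ 2 / 16 ≤ 1 / (16 * J ^ 2) - a ^ 2 / 16 + a / 8 * X := by
      have : (1 : ℝ) / (16 * J ^ 2) = 1 / J ^ 2 / 16 := by field_simp
      rw [this]; nlinarith
    calc n * (X ^ 2 / 16) ≤ n * (1 / (16 * J ^ 2) - a ^ 2 / 16 + a / 8 * X) := by gcongr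
      _ = _ := by ring
  refine (lintegral_mono hpt).trans ?_
  rw [lintegral_finsetSum S fun j _ => (hTm j).const_mul _, ← hcard, ← nsmul_eq_mul]
  refine Finset.sum_le_card_nsmul _ _ _ fun j hj => ?_
  rw [lintegral_const_mul _ (hTm j), lintegral_ofReal_exp_sum (g := fun x => (j : ℝ) / J / 8 * g x)
    (hg.const_mul _)]
  have ha : |(j : ℝ) / J| ≤ 2 := by
    simp only [S, Finset.mem_Icc] at hj
    rw [abs_div, abs_of_pos hJ', div_le_iff₀ hJ']
    exact_mod_cast abs_le.2 hj
  calc _ ≤ ENNReal.ofReal (Real.exp (n * (1 / (16 * J ^ 2) - ((j : ℝ) / J) ^ 2 / 16))) *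
        ENNReal.ofReal (Real.exp (((j : ℝ) / J) ^ 2 / 16)) ^ n := by
        gcongr; exact lintegral_exp_centered_le hg hg2 hg0 ha
    _ = _ := by
        rw [← ENNReal.ofReal_pow (Real.exp_pos _).le, ← Real.exp_nat_mul,
          ← ENNReal.ofReal_mul (Real.exp_pos _).le, ← Real.exp_add]
        congr 2; ring

lemma lintegral_exp_indicator_le [MeasurableSingletonClass E] {S : Set E} (hS : MeasurableSet S)
    {p : ℝ} (hp : ν.real S ≤ p) {b : ℝ} (hb : 0 ≤ b) {n : ℕ} (hn : n ≠ 0) :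
    ∫⁻ z, ENNReal.ofReal (Real.exp (n * (b * (emp z).real S))) ∂Measure.pi (fun _ : Fin n => ν) ≤
      ENNReal.ofReal (Real.exp (n * (p * Real.exp b))) := by
  set g : E → ℝ := fun x => b * S.indicator (fun _ => (1 : ℝ)) x with hgdef
  have hg : Measurable g := (measurable_const.indicator hS).const_mul b
  have hn' : (n : ℝ) ≠ 0 := by exact_mod_cast hn
  have h1 : ∀ z : Fin n → E, n * (b * (emp z).real S) = ∑ i, g (z i) := fun z => by
    rw [emp_real z hS, hgdef, ← Finset.mul_sum]; field_simp
  have hg' : ∀ x, Real.exp (g x) ≤ 1 + Real.exp b * S.indicator (fun _ => (1 : ℝ)) x := fun x => by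
    by_cases hx : x ∈ S <;> simp [g, hx]
  have hgb : ∀ x, |g x| ≤ b := fun x => by
    by_cases hx : x ∈ S <;> simp [g, hx, abs_of_nonneg hb, hb]
  have hI := integrable_exp_of_abs_le (μ := ν) hg hgb
  have hIS : Integrable (S.indicator fun _ => (1 : ℝ)) ν := (integrable_const _).indicator hS
  have hI2 : Integrable (fun x => 1 + Real.exp b * S.indicator (fun _ => (1 : ℝ)) x) ν :=
    (integrable_const _).add (hIS.const_mul _)
  simp_rw [h1]
  rw [lintegral_ofReal_exp_sum hg, ← ofReal_integral_eq_lintegral_ofReal hI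
    (ae_of_all _ fun x => (Real.exp_pos _).le), Real.exp_nat_mul,
    ENNReal.ofReal_pow (Real.exp_pos _).le]
  gcongr
  calc ∫ x, Real.exp (g x) ∂ν ≤ ∫ x, (1 + Real.exp b * S.indicator (fun _ => (1 : ℝ)) x) ∂ν :=
        integral_mono hI hI2 hg'
    _ = Real.exp b * ν.real S + 1 := by
        rw [integral_add (integrable_const _) (hIS.const_mul _), integral_const_mul,
          integral_indicator_const _ hS]
        simp; ring
    _ ≤ p * Real.exp b + 1 := by
        rw [mul_comm]; gcongr
    _ ≤ _ := Real.add_one_le_exp _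

end Moments

/-! ### Points in general position -/

/-- No two of the points share a coordinate. -/
def Generic {n : ℕ} (z : Fin n → Ω2) : Prop :=
  (Function.Injective fun i => (z i).1) ∧ Function.Injective fun i => (z i).2

lemma measure_fst_eq {ν : ProbabilityMeasure Ω2} (hν : ν ∈ Mcal) (x : ℝ) :
    (ν : Measure Ω2) {p | p.1 = x} = 0 := by
  have := hν.2.1 x
  rwa [Measure.map_apply measurable_fst (measurableSet_singleton x)] at this

lemma measure_snd_eq {ν : ProbabilityMeasure Ω2} (hν : ν ∈ Mcal) (x : ℝ) :
    (ν : Measure Ω2) {p | p.2 = x} = 0 := by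
  have := hν.2.2 x
  rwa [Measure.map_apply measurable_snd (measurableSet_singleton x)] at this

lemma ae_generic {ν : ProbabilityMeasure Ω2} (hν : ν ∈ Mcal) (n : ℕ) :
    ∀ᵐ z ∂pmeas (ν : Measure Ω2) n, Generic z := by
  have h : ∀ i j : Fin n, i ≠ j → ∀ᵐ z ∂pmeas (ν : Measure Ω2) n,
      (z i).1 ≠ (z j).1 ∧ (z i).2 ≠ (z j).2 := by
    intro i j hij
    have h1 := pi_pair_le (fun _ : Fin n => (ν : Measure Ω2)) hij
      (S := {q : Ω2 × Ω2 | q.2.1 = q.1.1}) (p := 0)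
      (measurableSet_eq_fun (by fun_prop) (by fun_prop)) fun a => (measure_fst_eq hν a.1).le
    have h2 := pi_pair_le (fun _ : Fin n => (ν : Measure Ω2)) hij
      (S := {q : Ω2 × Ω2 | q.2.2 = q.1.2}) (p := 0)
      (measurableSet_eq_fun (by fun_prop) (by fun_prop)) fun a => (measure_snd_eq hν a.2).le
    have h1' : ∀ᵐ z ∂pmeas (ν : Measure Ω2) n, ¬ (z j).1 = (z i).1 :=
      measure_eq_zero_iff_ae_notMem.1 (nonpos_iff_eq_zero.1 h1)
    have h2' : ∀ᵐ z ∂pmeas (ν : Measure Ω2) n, ¬ (z j).2 = (z i).2 :=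
      measure_eq_zero_iff_ae_notMem.1 (nonpos_iff_eq_zero.1 h2)
    filter_upwards [h1', h2'] with z hz1 hz2
    exact ⟨Ne.symm hz1, Ne.symm hz2⟩
  have h' : ∀ᵐ z ∂pmeas (ν : Measure Ω2) n, ∀ i j : Fin n, i ≠ j →
      (z i).1 ≠ (z j).1 ∧ (z i).2 ≠ (z j).2 := by
    rw [ae_all_iff]; intro i
    rw [ae_all_iff]; intro j
    by_cases hij : i = j
    · simp [hij]
    · filter_upwards [h i j hij] with z hz _ using hz
  filter_upwards [h'] with z hz
  exact ⟨fun i j hij => by_contra fun hne => (hz i j hne).1 hij,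
    fun i j hij => by_contra fun hne => (hz i j hne).2 hij⟩

lemma hPat_inducedPerm {n : ℕ} {z : Fin n → Ω2} (hz : Generic z) : hPat (inducedPerm z) z = 1 := by
  have hex : ∃ σ : Equiv.Perm (Fin n), hPat σ z = 1 := by
    set τ := Tuple.sort fun i => (z i).1
    set τ' := Tuple.sort fun i => (z i).2
    have h1 : StrictMono fun i => (z (τ i)).1 :=
      (Tuple.monotone_sort fun i => (z i).1).strictMono_of_injective (hz.1.comp τ.injective)
    have h2 : StrictMono fun i => (z (τ' i)).2 :=
      (Tuple.monotone_sort fun i => (z i).2).strictMono_of_injective (hz.2.comp τ'.injective)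
    refine ⟨τ'⁻¹ * τ, (hPat_eq_one_iff _ _).2 ⟨τ, h1, ?_⟩⟩
    simpa using h2
  rw [inducedPerm, dif_pos hex]
  exact hex.choose_spec

/-- The pair of marginal distribution functions. -/
def cdfPair (ν : Measure Ω2) (p : Ω2) : Ω2 := (cdfX ν p.1, cdfY ν p.2)

lemma monotone_cdfX (ν : Measure Ω2) [IsFiniteMeasure ν] : Monotone (cdfX ν) := fun _ _ h =>
  measureReal_mono (μ := ν) fun _ hp => le_trans hp h

lemma monotone_cdfY (ν : Measure Ω2) [IsFiniteMeasure ν] : Monotone (cdfY ν) := fun _ _ h =>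
  measureReal_mono (μ := ν) fun _ hp => le_trans hp h

lemma measurable_cdfPair (ν : Measure Ω2) [IsFiniteMeasure ν] : Measurable (cdfPair ν) :=
  ((monotone_cdfX ν).measurable.comp measurable_fst).prodMk
    ((monotone_cdfY ν).measurable.comp measurable_snd)

lemma cdfX_emp {n : ℕ} (z : Fin n → Ω2) (x : ℝ) :
    cdfX (emp z) x = (Finset.univ.filter fun j => (z j).1 ≤ x).card / n := by
  have h := emp_real z (S := {p : Ω2 | p.1 ≤ x}) (measurableSet_le measurable_fst measurable_const)
  rw [cdfX, ← measureReal_def, h, inv_mul_eq_div]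
  simp [Set.indicator_apply, Finset.sum_boole]

lemma cdfY_emp {n : ℕ} (z : Fin n → Ω2) (x : ℝ) :
    cdfY (emp z) x = (Finset.univ.filter fun j => (z j).2 ≤ x).card / n := by
  have h := emp_real z (S := {p : Ω2 | p.2 ≤ x}) (measurableSet_le measurable_snd measurable_const)
  rw [cdfY, ← measureReal_def, h, inv_mul_eq_div]
  simp [Set.indicator_apply, Finset.sum_boole]

lemma card_filter_le_of_strictMono {n : ℕ} {x : Fin n → ℝ} {τ : Equiv.Perm (Fin n)}
    (h : StrictMono fun i => x (τ i)) (i : Fin n) :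
    (Finset.univ.filter fun j => x j ≤ x (τ i)).card = (i : ℕ) + 1 := by
  have : (Finset.univ.filter fun j => x j ≤ x (τ i)) = (Finset.Iic i).map τ.toEmbedding := by
    ext j
    simp only [Finset.mem_filter, Finset.mem_univ, true_and, Finset.mem_map_equiv, Finset.mem_Iic]
    rw [← h.le_iff_le]; simp
  rw [this, Finset.card_map, Fin.card_Iic]

/-- For points in general position the permuton of the induced permutation is obtained from the
empirical measure by normalizing its marginals. -/
lemma EmM_inducedPerm {n : ℕ} {z : Fin n → Ω2} (hz : Generic z) (hn : n ≠ 0) :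
    EmM (inducedPerm z) = (emp z).map (cdfPair (emp z)) := by
  have := isProbabilityMeasure_emp hn z
  obtain ⟨τ, h1, h2⟩ := (hPat_eq_one_iff _ _).1 (hPat_inducedPerm hz)
  rw [emp_map z (measurable_cdfPair _), EmM, emp, 
    ← Equiv.sum_comp τ fun i => Measure.dirac ((cdfPair (emp z) ∘ z) i)]
  congr 1
  refine Finset.sum_congr rfl fun i _ => ?_
  congr 1
  simp only [Function.comp, cdfPair, cdfX_emp, cdfY_emp]
  rw [card_filter_le_of_strictMono (x := fun j => (z j).1) (τ := τ) h1]
  have h3 := card_filter_le_of_strictMono (x := fun j => (z j).2)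
    (τ := τ * (inducedPerm z)⁻¹) h2 (inducedPerm z i)
  simp only [Equiv.Perm.mul_apply, Equiv.Perm.inv_def, Equiv.symm_apply_apply] at h3
  rw [h3]
  push_cast
  rfl

lemma cdfX_emp_lt_iff {n : ℕ} (z : Fin n → Ω2) (i j : Fin n) :
    cdfX (emp z) (z i).1 < cdfX (emp z) (z j).1 ↔ (z i).1 < (z j).1 := by
  have hn : n ≠ 0 := fun h => by subst h; exact i.elim0
  have := isProbabilityMeasure_emp hn z
  constructor
  · intro h
    by_contra! hle
    exact absurd (monotone_cdfX (emp z) hle) (not_le.2 h)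
  · intro h
    rw [cdfX_emp, cdfX_emp]
    have hn' : (0 : ℝ) < n := by positivity
    gcongr
    refine Finset.ssubset_iff_of_subset
      (fun l hl => ?_) |>.2 ⟨j, by simp, by simpa using h⟩
    simp only [Finset.mem_filter, Finset.mem_univ, true_and] at hl ⊢
    exact hl.trans h.le

lemma cdfY_emp_lt_iff {n : ℕ} (z : Fin n → Ω2) (i j : Fin n) :
    cdfY (emp z) (z i).2 < cdfY (emp z) (z j).2 ↔ (z i).2 < (z j).2 := by
  have hn : n ≠ 0 := fun h => by subst h; exact i.elim0
  have := isProbabilityMeasure_emp hn z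
  constructor
  · intro h
    by_contra! hle
    exact absurd (monotone_cdfY (emp z) hle) (not_le.2 h)
  · intro h
    rw [cdfY_emp, cdfY_emp]
    have hn' : (0 : ℝ) < n := by positivity
    gcongr
    refine Finset.ssubset_iff_of_subset
      (fun l hl => ?_) |>.2 ⟨j, by simp, by simpa using h⟩
    simp only [Finset.mem_filter, Finset.mem_univ, true_and] at hl ⊢
    exact hl.trans h.le

lemma emp_ae_mem_range {n : ℕ} (z : Fin n → Ω2) : ∀ᵐ p ∂emp z, p ∈ Set.range z := by
  rw [emp]
  refine Measure.ae_smul_measure ?_ _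
  rw [ae_finsetSum_measure_iff]
  intro i _
  exact (ae_dirac_iff (p := fun p => p ∈ Set.range z) (Set.finite_range z).measurableSet).2 ⟨i, rfl⟩

lemma tPerm_inducedPerm {k n : ℕ} (σ : Equiv.Perm (Fin k)) {z : Fin n → Ω2} (hz : Generic z)
    (hn : n ≠ 0) : tPerm σ (inducedPerm z) = tPat σ (emp z) := by
  have := isProbabilityMeasure_emp hn z
  rw [tPerm, EmM_inducedPerm hz hn, tPat_map (measurable_cdfPair _), tPat]
  refine integral_congr_ae ?_
  have h : ∀ᵐ w ∂Measure.pi (fun _ : Fin k => emp z), ∀ i, w i ∈ Set.range z :=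
    ae_all_iff.2 fun i => (Measure.quasiMeasurePreserving_eval _ i).ae (emp_ae_mem_range z)
  filter_upwards [h] with w hw
  choose j hj using hw
  simp only [hPat, StrictMono, cdfPair, ← hj, cdfX_emp_lt_iff, cdfY_emp_lt_iff]

/-! ### Discretization along the marginal quantiles -/

lemma measureReal_floor_cdf_le (κ : Measure ℝ) [IsProbabilityMeasure κ] (hκ : ∀ x, κ {x} = 0)
    {m : ℕ} (hm : m ≠ 0) (j : ℕ) :
    κ.real {x | ⌊m * κ.real (Set.Iic x)⌋₊ = j} ≤ 1 / m := by
  have hmono : Monotone fun x => κ.real (Set.Iic x) := fun _ _ h =>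
    measureReal_mono (Set.Iic_subset_Iic.2 h)
  have hI : MeasurableSet {x | ⌊m * κ.real (Set.Iic x)⌋₊ = j} :=
    (Nat.measurable_floor.comp (hmono.measurable.const_mul _)) (measurableSet_singleton j)
  have hm' : (0 : ℝ) < m := by positivity
  by_contra! hlt
  have hlt' : ENNReal.ofReal (1 / m) < κ {x | ⌊m * κ.real (Set.Iic x)⌋₊ = j} := by
    rwa [ENNReal.ofReal_lt_iff_lt_toReal (by positivity) (measure_ne_top _ _)]
  obtain ⟨K, hKI, hK, hKlt⟩ := hI.exists_lt_isCompact hlt'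
  have hne : K.Nonempty := by
    by_contra h
    rw [Set.not_nonempty_iff_eq_empty.1 h] at hKlt
    simp at hKlt
  obtain ⟨a, haK, ha⟩ := hK.exists_isLeast hne
  obtain ⟨b, hbK, hb⟩ := hK.exists_isGreatest hne
  have hab : a ≤ b := ha hbK
  have h1 : κ K ≤ κ (Set.Ioc a b) := by
    have h2 : K ⊆ {a} ∪ Set.Ioc a b := fun x hx => by
      rcases (ha hx).eq_or_lt with h | h
      · exact Or.inl h.symm
      · exact Or.inr ⟨h, hb hx⟩
    calc κ K ≤ κ ({a} ∪ Set.Ioc a b) := measure_mono h2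
      _ ≤ κ {a} + κ (Set.Ioc a b) := measure_union_le _ _
      _ = _ := by rw [hκ, zero_add]
  have h3 : κ.real (Set.Iic b) = κ.real (Set.Iic a) + κ.real (Set.Ioc a b) := by
    rw [← Set.Iic_union_Ioc_eq_Iic hab, measureReal_union (Set.Iic_disjoint_Ioc le_rfl)
      measurableSet_Ioc]
  have h4 : 1 / m < κ.real (Set.Ioc a b) :=
    (ENNReal.ofReal_lt_iff_lt_toReal (by positivity) (measure_ne_top _ _)).1 (hKlt.trans_le h1)
  have h5 := (Nat.floor_eq_iff (by positivity)).1 (hKI haK)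
  have h6 := (Nat.floor_eq_iff (by positivity)).1 (hKI hbK)
  rw [div_lt_iff₀ hm'] at h4
  nlinarith [h5.1, h6.2]

section Mesh

variable (ν : Measure Ω2) (m : ℕ)

/-- The cell of the quantile mesh of `ν` containing a point. -/
def cell (p : Ω2) : ℕ × ℕ := (⌊m * cdfX ν p.1⌋₊, ⌊m * cdfY ν p.2⌋₊)

/-- Total discrepancy between `ρ` and `ν` on the cells of the mesh. -/
def discr (ρ : Measure Ω2) : ℝ :=
  ∑ b ∈ Finset.range (m + 1) ×ˢ Finset.range (m + 1),
    |ρ.real (cell ν m ⁻¹' {b}) - ν.real (cell ν m ⁻¹' {b})|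

/-- Vertical (`false`) and horizontal (`true`) strips of the mesh. -/
def strip (c : Bool) (j : ℕ) : Set Ω2 :=
  {p | (bif c then (cell ν m p).2 else (cell ν m p).1) = j}

/-- Largest mass of a strip. -/
def maxStrip (ρ : Measure Ω2) : ℝ := ⨆ q : Bool × Fin (m + 1), ρ.real (strip ν m q.1 q.2)

lemma cdfX_nonneg (x : ℝ) : 0 ≤ cdfX ν x := ENNReal.toReal_nonneg

lemma cdfY_nonneg (x : ℝ) : 0 ≤ cdfY ν x := ENNReal.toReal_nonneg

lemma exists_eq_maxStrip (ρ : Measure Ω2) :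
    ∃ q : Bool × Fin (m + 1), ρ.real (strip ν m q.1 q.2) = maxStrip ν m ρ :=
  exists_eq_ciSup_of_finite (f := fun q : Bool × Fin (m + 1) => ρ.real (strip ν m q.1 q.2))

lemma discr_nonneg (ρ : Measure Ω2) : 0 ≤ discr ν m ρ := Finset.sum_nonneg fun _ _ => abs_nonneg _

variable [IsProbabilityMeasure ν]

lemma cdfX_le_one (x : ℝ) : cdfX ν x ≤ 1 := measureReal_le_one

lemma cdfY_le_one (x : ℝ) : cdfY ν x ≤ 1 := measureReal_le_one

lemma measurable_cell : Measurable (cell ν m) :=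
  (Nat.measurable_floor.comp (((monotone_cdfX ν).measurable.comp measurable_fst).const_mul _)).prodMk
    (Nat.measurable_floor.comp (((monotone_cdfY ν).measurable.comp measurable_snd).const_mul _))

lemma cell_fst_mono {p q : Ω2} (h : p.1 ≤ q.1) : (cell ν m p).1 ≤ (cell ν m q).1 :=
  Nat.floor_le_floor (by have := monotone_cdfX ν h; gcongr)

lemma cell_snd_mono {p q : Ω2} (h : p.2 ≤ q.2) : (cell ν m p).2 ≤ (cell ν m q).2 :=
  Nat.floor_le_floor (by have := monotone_cdfY ν h; gcongr)

lemma cell_fst_le (p : Ω2) : (cell ν m p).1 ≤ m :=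
  Nat.floor_le_of_le (mul_le_of_le_one_right (Nat.cast_nonneg m) (cdfX_le_one ν _))

lemma cell_snd_le (p : Ω2) : (cell ν m p).2 ≤ m :=
  Nat.floor_le_of_le (mul_le_of_le_one_right (Nat.cast_nonneg m) (cdfY_le_one ν _))

lemma cell_mem (p : Ω2) : cell ν m p ∈ Finset.range (m + 1) ×ˢ Finset.range (m + 1) := by
  simp only [Finset.mem_product, Finset.mem_range, Nat.lt_succ_iff]
  exact ⟨cell_fst_le ν m p, cell_snd_le ν m p⟩

lemma measurableSet_strip (c : Bool) (j : ℕ) : MeasurableSet (strip ν m c j) := by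
  have := measurable_cell ν m
  cases c
  · exact this.fst (measurableSet_singleton j)
  · exact this.snd (measurableSet_singleton j)

lemma le_maxStrip (ρ : Measure Ω2) [IsProbabilityMeasure ρ] (c : Bool) (j : ℕ) :
    ρ.real (strip ν m c j) ≤ maxStrip ν m ρ := by
  have hle : ∀ q : Bool × Fin (m + 1), ρ.real (strip ν m q.1 q.2) ≤ maxStrip ν m ρ := fun q =>
    le_ciSup (f := fun q : Bool × Fin (m + 1) => ρ.real (strip ν m q.1 q.2))
      (Set.finite_range _).bddAbove q
  by_cases hj : j < m + 1
  · exact hle (c, ⟨j, hj⟩)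
  · have : strip ν m c j = ∅ := by
      ext p
      have h1 := cell_fst_le ν m p
      have h2 := cell_snd_le ν m p
      cases c <;> simp [strip] <;> omega
    rw [this, measureReal_empty]
    exact measureReal_nonneg.trans (hle (false, 0))

lemma maxStrip_nonneg (ρ : Measure Ω2) [IsProbabilityMeasure ρ] : 0 ≤ maxStrip ν m ρ :=
  measureReal_nonneg.trans (le_maxStrip ν m ρ false 0)

lemma integral_cell (ρ : Measure Ω2) [IsProbabilityMeasure ρ] (f : ℕ × ℕ → ℝ) :
    ∫ p, f (cell ν m p) ∂ρ = ∑ b ∈ Finset.range (m + 1) ×ˢ Finset.range (m + 1),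
      f b * ρ.real (cell ν m ⁻¹' {b}) := by
  have hm : ∀ b, MeasurableSet (cell ν m ⁻¹' {b}) := fun b =>
    measurable_cell ν m (measurableSet_singleton b)
  have h : ∀ p, f (cell ν m p) = ∑ b ∈ Finset.range (m + 1) ×ˢ Finset.range (m + 1),
      f b * (cell ν m ⁻¹' {b}).indicator (fun _ => (1 : ℝ)) p := by
    intro p
    rw [Finset.sum_eq_single (cell ν m p)]
    · simp
    · intro b _ hb
      rw [Set.indicator_of_notMem (by simpa using Ne.symm hb), mul_zero]
    · intro h; exact absurd (cell_mem ν m p) h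
  simp_rw [h]
  rw [integral_finsetSum _ fun b _ => ((integrable_const _).indicator (hm b)).const_mul _]
  refine Finset.sum_congr rfl fun b _ => ?_
  rw [integral_const_mul, integral_indicator_const _ (hm b)]; simp

lemma abs_integral_cell_sub_le (ρ : Measure Ω2) [IsProbabilityMeasure ρ] (f : ℕ × ℕ → ℝ)
    (hf : ∀ b, |f b| ≤ 1) :
    |∫ p, f (cell ν m p) ∂ρ - ∫ p, f (cell ν m p) ∂ν| ≤ discr ν m ρ := by
  rw [integral_cell, integral_cell, ← Finset.sum_sub_distrib]
  refine (Finset.abs_sum_le_sum_abs _ _).trans (Finset.sum_le_sum fun b _ => ?_)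
  rw [← mul_sub, abs_mul]
  exact mul_le_of_le_one_left (abs_nonneg _) (hf b)

lemma abs_measureReal_cell_sub_le (ρ : Measure Ω2) [IsProbabilityMeasure ρ] (U : Set (ℕ × ℕ)) :
    |ρ.real (cell ν m ⁻¹' U) - ν.real (cell ν m ⁻¹' U)| ≤ discr ν m ρ := by
  have hU : MeasurableSet (cell ν m ⁻¹' U) := measurable_cell ν m (MeasurableSet.of_discrete)
  have h : ∀ ρ : Measure Ω2, ∫ p, U.indicator (fun _ => (1 : ℝ)) (cell ν m p) ∂ρ =
      ρ.real (cell ν m ⁻¹' U) := fun ρ => by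
    have := integral_indicator_const (μ := ρ) (1 : ℝ) hU
    simp only [smul_eq_mul, mul_one] at this
    rw [← this]; rfl
  rw [← h, ← h]
  refine abs_integral_cell_sub_le ν m ρ _ fun b => ?_
  by_cases hb : b ∈ U <;> simp [hb]

/-- The cell of a point, viewed in the plane. -/
def cellPt (p : Ω2) : Ω2 := ((cell ν m p).1, (cell ν m p).2)

lemma measurable_cellPt : Measurable (cellPt ν m) := by
  have := measurable_cell ν m
  exact (measurable_from_nat.comp this.fst).prodMk (measurable_from_nat.comp this.snd)

lemma tvBound_cellPt (ρ : Measure Ω2) [IsProbabilityMeasure ρ] :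
    TVBound (ν.map (cellPt ν m)) (ρ.map (cellPt ν m)) (discr ν m ρ) := by
  intro f hf hf1
  rw [integral_map_of_measurable (measurable_cellPt ν m) hf,
    integral_map_of_measurable (measurable_cellPt ν m) hf]
  exact abs_integral_cell_sub_le ν m ρ (fun b => f (b.1, b.2)) fun b => hf1 _

lemma hPat_cellPt {n : ℕ} (σ : Equiv.Perm (Fin n)) {w : Fin n → Ω2}
    (h : ∀ i j, i ≠ j → (cell ν m (w i)).1 ≠ (cell ν m (w j)).1 ∧
      (cell ν m (w i)).2 ≠ (cell ν m (w j)).2) :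
    hPat σ (fun i => cellPt ν m (w i)) = hPat σ w := by
  have h1 : ∀ i j, (cellPt ν m (w i)).1 < (cellPt ν m (w j)).1 ↔ (w i).1 < (w j).1 := by
    intro i j
    simp only [cellPt, Nat.cast_lt]
    constructor
    · intro hlt
      by_contra! hle
      exact absurd (cell_fst_mono ν m hle) (not_le.2 hlt)
    · intro hlt
      have hij : i ≠ j := by rintro rfl; exact lt_irrefl _ hlt
      exact lt_of_le_of_ne (cell_fst_mono ν m hlt.le) (h i j hij).1
  have h2 : ∀ i j, (cellPt ν m (w i)).2 < (cellPt ν m (w j)).2 ↔ (w i).2 < (w j).2 := by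
    intro i j
    simp only [cellPt, Nat.cast_lt]
    constructor
    · intro hlt
      by_contra! hle
      exact absurd (cell_snd_mono ν m hle) (not_le.2 hlt)
    · intro hlt
      have hij : i ≠ j := by rintro rfl; exact lt_irrefl _ hlt
      exact lt_of_le_of_ne (cell_snd_mono ν m hlt.le) (h i j hij).2
  unfold hPat
  exact if_congr (by simp only [StrictMono, h1, h2]) rfl rfl

/-- Pairs of points lying in a common strip. -/
def samePair (c : Bool) : Set (Ω2 × Ω2) :=
  {q | (bif c then (cell ν m q.2).2 else (cell ν m q.2).1) =
    bif c then (cell ν m q.1).2 else (cell ν m q.1).1}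

lemma measurableSet_samePair (c : Bool) : MeasurableSet (samePair ν m c) := by
  have h := measurable_cell ν m
  cases c
  · exact measurableSet_eq_fun (h.comp measurable_snd).fst (h.comp measurable_fst).fst
  · exact measurableSet_eq_fun (h.comp measurable_snd).snd (h.comp measurable_fst).snd

lemma abs_integral_hPat_cellPt_le {n : ℕ} (σ : Equiv.Perm (Fin n)) (ρ : Fin n → Measure Ω2)
    [∀ i, IsProbabilityMeasure (ρ i)] {e : ℝ} (he : ∀ i c j, (ρ i).real (strip ν m c j) ≤ e) :
    |∫ w, hPat σ w ∂Measure.pi ρ - ∫ w, hPat σ w ∂Measure.pi fun i => (ρ i).map (cellPt ν m)| ≤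
      2 * n ^ 2 * e := by
  classical
  have hmc := measurable_cellPt ν m
  have hpm : ∀ i, IsProbabilityMeasure ((ρ i).map (cellPt ν m)) := fun i =>
    Measure.isProbabilityMeasure_map hmc.aemeasurable
  have hmc' : Measurable fun (w : Fin n → Ω2) i => cellPt ν m (w i) :=
    measurable_pi_lambda _ fun i => hmc.comp (measurable_pi_apply i)
  rw [← Measure.pi_map_pi (fun i => hmc.aemeasurable),
    integral_map_of_measurable hmc' (measurable_hPat σ)]
  have hI1 : Integrable (hPat σ) (Measure.pi ρ) :=
    integrable_of_abs_le (measurable_hPat σ) (hPat_abs_le σ)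
  have hI2 : Integrable (fun w => hPat σ fun i => cellPt ν m (w i)) (Measure.pi ρ) :=
    integrable_of_abs_le ((measurable_hPat σ).comp hmc') fun w => hPat_abs_le σ _
  rw [← integral_sub hI1 hI2]
  let T : Bool → Fin n × Fin n → Set (Fin n → Ω2) := fun c q => {w | (w q.1, w q.2) ∈ samePair ν m c}
  have hT : ∀ c q, MeasurableSet (T c q) := fun c q =>
    ((measurable_pi_apply q.1).prodMk (measurable_pi_apply q.2)) (measurableSet_samePair ν m c)
  set D : Finset (Fin n × Fin n) := Finset.univ.offDiag
  have hIT : ∀ c q, Integrable ((T c q).indicator fun _ => (1 : ℝ)) (Measure.pi ρ) := fun c q =>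
    (integrable_const _).indicator (hT c q)
  have hIs : Integrable (fun w => ∑ q ∈ D, ∑ c : Bool, (T c q).indicator (fun _ => (1 : ℝ)) w)
      (Measure.pi ρ) := integrable_finsetSum _ fun q _ => integrable_finsetSum _ fun c _ => hIT c q
  have hpt : ∀ w : Fin n → Ω2, |hPat σ w - hPat σ fun i => cellPt ν m (w i)| ≤
      ∑ q ∈ D, ∑ c : Bool, (T c q).indicator (fun _ => (1 : ℝ)) w := by
    intro w
    have hnn : ∀ q c, 0 ≤ (T c q).indicator (fun _ => (1 : ℝ)) w := fun q c =>
      Set.indicator_nonneg (fun _ _ => zero_le_one) _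
    by_cases hex : ∃ q ∈ D, ∃ c, w ∈ T c q
    · obtain ⟨q, hq, c, hc⟩ := hex
      have h1 : |hPat σ w - hPat σ fun i => cellPt ν m (w i)| ≤ 1 :=
        abs_sub_le_iff.2 ⟨by linarith [hPat_le_one σ w, hPat_nonneg σ fun i => cellPt ν m (w i)],
          by linarith [hPat_le_one σ fun i => cellPt ν m (w i), hPat_nonneg σ w]⟩
      refine h1.trans ?_
      calc (1 : ℝ) = (T c q).indicator (fun _ => (1 : ℝ)) w := by simp [hc]
        _ ≤ ∑ c : Bool, (T c q).indicator (fun _ => (1 : ℝ)) w :=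
            Finset.single_le_sum (f := fun c => (T c q).indicator (fun _ => (1 : ℝ)) w)
              (fun c _ => hnn q c) (Finset.mem_univ c)
        _ ≤ _ := Finset.single_le_sum
              (f := fun q => ∑ c : Bool, (T c q).indicator (fun _ => (1 : ℝ)) w)
              (fun q _ => Finset.sum_nonneg fun c _ => hnn q c) hq
    · push Not at hex
      rw [hPat_cellPt ν m σ fun i j hij => ?_, sub_self, abs_zero]
      · exact Finset.sum_nonneg fun q _ => Finset.sum_nonneg fun c _ => hnn q c
      · have hq : (i, j) ∈ D := by simpa [D] using hij
        exact ⟨fun h => hex _ hq false h.symm, fun h => hex _ hq true h.symm⟩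
  have he0 : ∀ i : Fin n, 0 ≤ e := fun i => measureReal_nonneg.trans (he i false 0)
  have hTe : ∀ q ∈ D, ∀ c, (Measure.pi ρ).real (T c q) ≤ e := by
    intro q hq c
    refine ENNReal.toReal_le_of_le_ofReal (he0 q.1) ?_
    refine pi_pair_le ρ (by simpa [D] using hq) (measurableSet_samePair ν m c) fun a => ?_
    rw [← ofReal_measureReal]
    exact ENNReal.ofReal_le_ofReal 
      (he q.2 c (bif c then (cell ν m a).2 else (cell ν m a).1))
  calc |∫ w, (hPat σ w - hPat σ fun i => cellPt ν m (w i)) ∂Measure.pi ρ|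
      ≤ ∫ w, |hPat σ w - hPat σ fun i => cellPt ν m (w i)| ∂Measure.pi ρ :=
        abs_integral_le_integral_abs
    _ ≤ ∫ w, ∑ q ∈ D, ∑ c : Bool, (T c q).indicator (fun _ => (1 : ℝ)) w ∂Measure.pi ρ :=
        integral_mono (hI1.sub hI2).abs hIs hpt
    _ = ∑ q ∈ D, ∑ c : Bool, (Measure.pi ρ).real (T c q) := by
        rw [integral_finsetSum _ fun q _ => integrable_finsetSum _ fun c _ => hIT c q]
        refine Finset.sum_congr rfl fun q _ => ?_
        rw [integral_finsetSum _ fun c _ => hIT c q]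
        refine Finset.sum_congr rfl fun c _ => ?_
        rw [integral_indicator_const _ (hT c q)]; simp
    _ ≤ ∑ q ∈ D, ∑ c : Bool, e :=
        Finset.sum_le_sum fun q hq => Finset.sum_le_sum fun c _ => hTe q hq c
    _ ≤ 2 * n ^ 2 * e := by
        rcases Nat.eq_zero_or_pos n with rfl | hn
        · simp [D]
        have hc : (D.card : ℝ) ≤ n ^ 2 := by
          have : D.card ≤ n ^ 2 := by
            simp only [D, Finset.offDiag_card, Finset.card_univ, Fintype.card_fin]
            rw [sq]; exact Nat.sub_le _ _
          exact_mod_cast this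
        simp only [Finset.sum_const, Finset.card_univ, Fintype.card_bool, nsmul_eq_mul]
        have := mul_le_mul_of_nonneg_right hc (he0 ⟨0, hn⟩)
        push_cast
        linarith

lemma abs_tRem_le_of_strip {k : ℕ} (σ : Equiv.Perm (Fin (k + 1))) (ρ : Measure Ω2)
    [IsProbabilityMeasure ρ] (hs : ∀ c j, ν.real (strip ν m c j) ≤ 1 / m) :
    |tRem σ ν ρ| ≤
      (k + 1) ^ 2 * discr ν m ρ ^ 2 + 8 * (k + 1) ^ 3 * (maxStrip ν m ρ + 1 / m) := by
  have hmc := measurable_cellPt ν m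
  have hp1 : IsProbabilityMeasure (ν.map (cellPt ν m)) :=
    Measure.isProbabilityMeasure_map hmc.aemeasurable
  have hp2 : IsProbabilityMeasure (ρ.map (cellPt ν m)) :=
    Measure.isProbabilityMeasure_map hmc.aemeasurable
  have h0 := (tvBound_cellPt ν m ρ).abs_tRem_le σ
  set e : ℝ := maxStrip ν m ρ + 1 / m with he
  have hm0 : (0 : ℝ) ≤ 1 / m := by positivity
  have heρ : ∀ c j, ρ.real (strip ν m c j) ≤ e := fun c j => by
    linarith [le_maxStrip ν m ρ c j]
  have heν : ∀ c j, ν.real (strip ν m c j) ≤ e := fun c j => by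
    linarith [hs c j, maxStrip_nonneg ν m ρ]
  have he0 : 0 ≤ e := add_nonneg (maxStrip_nonneg ν m ρ) hm0
  have h1 := abs_integral_hPat_cellPt_le ν m σ (fun _ => ρ) fun _ => heρ
  have h2 := abs_integral_hPat_cellPt_le ν m σ (fun _ => ν) fun _ => heν
  have hinst : ∀ i : Fin (k + 1),
      IsProbabilityMeasure ((Fin.cons ρ (fun _ => ν) : Fin (k + 1) → Measure Ω2) i) := by
    intro i
    refine Fin.cases ?_ (fun _ => ?_) i
    · exact ‹IsProbabilityMeasure ρ›
    · exact ‹IsProbabilityMeasure ν›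
  have h3 := abs_integral_hPat_cellPt_le ν m σ
    (Fin.cons ρ (fun _ => ν) : Fin (k + 1) → Measure Ω2) (e := e) fun i => by
      refine Fin.cases ?_ (fun _ => ?_) i
      · exact heρ
      · exact heν
  have hcons : (fun i : Fin (k + 1) =>
      ((Fin.cons ρ (fun _ => ν) : Fin (k + 1) → Measure Ω2) i).map (cellPt ν m)) =
      Fin.cons (ρ.map (cellPt ν m)) fun _ => ν.map (cellPt ν m) := by
    funext i
    refine Fin.cases ?_ (fun _ => ?_) i <;> simp
  rw [hcons, integral_hPat_cons, integral_hPat_cons] at h3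
  change |tPat σ ρ - tPat σ (ρ.map (cellPt ν m))| ≤ _ at h1
  change |tPat σ ν - tPat σ (ν.map (cellPt ν m))| ≤ _ at h2
  push_cast at h1 h2 h3
  simp only [tRem] at h0 ⊢
  set K : ℝ := (k : ℝ) + 1 with hK
  have hK1 : 1 ≤ K := by rw [hK]; linarith [Nat.cast_nonneg (α := ℝ) k]
  have hKe : 2 * K ^ 2 * e ≤ 2 * K ^ 3 * e := by gcongr; norm_num
  have h4 : ∀ a a' b b' c c' r : ℝ, |a - a'| ≤ r → |b - b'| ≤ r → |c - c'| ≤ r →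
      |a - b - K * (c - b)| ≤ |a' - b' - K * (c' - b')| + (2 * r + 2 * (K * r)) := by
    intro a a' b b' c c' r ha hb hc
    have e1 : a - b - K * (c - b) = (a' - b' - K * (c' - b')) +
        (((a - a') - (b - b')) + K * ((b - b') - (c - c'))) := by ring
    have e2 : |K * ((b - b') - (c - c'))| ≤ K * (2 * r) := by
      rw [abs_mul, abs_of_pos (by linarith)]
      gcongr
      exact (abs_sub _ _).trans (by linarith)
    rw [e1]
    refine (abs_add_le _ _).trans ?_
    have := abs_add_le ((a - a') - (b - b')) (K * ((b - b') - (c - c')))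
    have := abs_sub (a - a') (b - b')
    linarith
  refine (h4 _ _ _ _ _ _ _ h1 h2 h3).trans ?_
  have h5 : K * (2 * K ^ 2 * e) = 2 * K ^ 3 * e := by ring
  linarith

variable {m}

lemma abs_cdfX_sub_le (ρ : Measure Ω2) [IsProbabilityMeasure ρ]
    (hs : ∀ c j, ν.real (strip ν m c j) ≤ 1 / m) (x : ℝ) :
    |cdfX ρ x - cdfX ν x| ≤ 1 / m + discr ν m ρ := by
  set j := (cell ν m (x, 0)).1
  have h1 : ∀ κ : Measure Ω2, IsProbabilityMeasure κ →
      κ.real (cell ν m ⁻¹' {b | b.1 < j}) ≤ cdfX κ x := fun κ _ =>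
    measureReal_mono fun p hp => show p.1 ≤ x by
      by_contra! h
      exact absurd (cell_fst_mono ν m (p := (x, 0)) (q := p) h.le) (not_le.2 hp)
  have h2 : ∀ κ : Measure Ω2, IsProbabilityMeasure κ →
      cdfX κ x ≤ κ.real (cell ν m ⁻¹' {b | b.1 ≤ j}) := fun κ _ =>
    measureReal_mono fun p (hp : p.1 ≤ x) => cell_fst_mono ν m (p := p) (q := (x, 0)) hp
  have h3 : ν.real (cell ν m ⁻¹' {b | b.1 ≤ j}) ≤
      ν.real (cell ν m ⁻¹' {b | b.1 < j}) + 1 / m := by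
    refine le_trans (measureReal_mono ?_) ((measureReal_union_le _ _).trans
      (add_le_add_right (hs false j) _))
    intro p (hp : (cell ν m p).1 ≤ j)
    exact hp.lt_or_eq
  have h4 := abs_sub_le_iff.1 (abs_measureReal_cell_sub_le ν m ρ {b | b.1 ≤ j})
  have h5 := abs_sub_le_iff.1 (abs_measureReal_cell_sub_le ν m ρ {b | b.1 < j})
  rw [abs_sub_le_iff]
  constructor <;> linarith [h1 ρ ‹_›, h1 ν ‹_›, h2 ρ ‹_›, h2 ν ‹_›]

lemma abs_cdfY_sub_le (ρ : Measure Ω2) [IsProbabilityMeasure ρ]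
    (hs : ∀ c j, ν.real (strip ν m c j) ≤ 1 / m) (x : ℝ) :
    |cdfY ρ x - cdfY ν x| ≤ 1 / m + discr ν m ρ := by
  set j := (cell ν m (0, x)).2
  have h1 : ∀ κ : Measure Ω2, IsProbabilityMeasure κ →
      κ.real (cell ν m ⁻¹' {b | b.2 < j}) ≤ cdfY κ x := fun κ _ =>
    measureReal_mono fun p hp => show p.2 ≤ x by
      by_contra! h
      exact absurd (cell_snd_mono ν m (p := (0, x)) (q := p) h.le) (not_le.2 hp)
  have h2 : ∀ κ : Measure Ω2, IsProbabilityMeasure κ →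
      cdfY κ x ≤ κ.real (cell ν m ⁻¹' {b | b.2 ≤ j}) := fun κ _ =>
    measureReal_mono fun p (hp : p.2 ≤ x) => cell_snd_mono ν m (p := p) (q := (0, x)) hp
  have h3 : ν.real (cell ν m ⁻¹' {b | b.2 ≤ j}) ≤
      ν.real (cell ν m ⁻¹' {b | b.2 < j}) + 1 / m := by
    refine le_trans (measureReal_mono ?_) ((measureReal_union_le _ _).trans
      (add_le_add_right (hs true j) _))
    intro p (hp : (cell ν m p).2 ≤ j)
    exact hp.lt_or_eq
  have h4 := abs_sub_le_iff.1 (abs_measureReal_cell_sub_le ν m ρ {b | b.2 ≤ j})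
  have h5 := abs_sub_le_iff.1 (abs_measureReal_cell_sub_le ν m ρ {b | b.2 < j})
  rw [abs_sub_le_iff]
  constructor <;> linarith [h1 ρ ‹_›, h1 ν ‹_›, h2 ρ ‹_›, h2 ν ‹_›]

lemma abs_sub_le_of_floor_eq (hm : m ≠ 0) {a b : ℝ} (ha : 0 ≤ a) (hb : 0 ≤ b)
    (h : ⌊m * a⌋₊ = ⌊m * b⌋₊) : |a - b| ≤ 1 / m := by
  have hm' : (0 : ℝ) < m := by positivity
  have h1 := (Nat.floor_eq_iff (by positivity)).1 h
  have h2 := (Nat.floor_eq_iff (n := ⌊(m : ℝ) * b⌋₊) (a := m * b) (by positivity)).1 rfl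
  rw [abs_sub_le_iff, le_div_iff₀ hm', le_div_iff₀ hm']
  constructor <;> nlinarith [h1.1, h1.2, h2.1, h2.2]

lemma dLPE_Omap_le (ρ : Measure Ω2) [IsProbabilityMeasure ρ] (hm : m ≠ 0)
    (hs : ∀ c j, ν.real (strip ν m c j) ≤ 1 / m) :
    dLPE (Omap ρ) (Omap ν) ≤ ENNReal.ofReal (2 / m + discr ν m ρ) := by
  have hρm := measurable_cdfPair ρ
  have hνm := measurable_cdfPair ν
  have hp1 : IsProbabilityMeasure (Omap ρ) := Measure.isProbabilityMeasure_map hρm.aemeasurable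
  have hp2 : IsProbabilityMeasure (Omap ν) := Measure.isProbabilityMeasure_map hνm.aemeasurable
  refine levyProkhorovEDist_le_of_forall_le _ _ _ fun ε B hε hε' hB => ?_
  have hd0 := discr_nonneg ν m ρ
  have hm0 : (0 : ℝ) ≤ 2 / m := by positivity
  have hε2 : 2 / m + discr ν m ρ < ε.toReal := (ENNReal.ofReal_lt_iff_lt_toReal (by positivity)
    hε'.ne).1 hε
  have e1 : Omap ρ B = ρ (cdfPair ρ ⁻¹' B) := Measure.map_apply hρm hB
  have e2 : Omap ν (Metric.thickening ε.toReal B) =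
      ν (cdfPair ν ⁻¹' Metric.thickening ε.toReal B) :=
    Measure.map_apply hνm Metric.isOpen_thickening.measurableSet
  rw [e1, e2]
  let U : Set (ℕ × ℕ) := cell ν m '' (cdfPair ρ ⁻¹' B)
  have hU1 : cdfPair ρ ⁻¹' B ⊆ cell ν m ⁻¹' U := Set.subset_preimage_image _ _
  have hU2 : cell ν m ⁻¹' U ⊆ cdfPair ν ⁻¹' Metric.thickening ε.toReal B := by
    rintro q ⟨p, hp, hpq⟩
    refine Metric.mem_thickening_iff.2 ⟨cdfPair ρ p, hp, lt_of_le_of_lt ?_ hε2⟩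
    have hx : |cdfX ν q.1 - cdfX ν p.1| ≤ 1 / m :=
      abs_sub_le_of_floor_eq hm (cdfX_nonneg ν _) (cdfX_nonneg ν _) (congrArg Prod.fst hpq).symm
    have hy : |cdfY ν q.2 - cdfY ν p.2| ≤ 1 / m :=
      abs_sub_le_of_floor_eq hm (cdfY_nonneg ν _) (cdfY_nonneg ν _) (congrArg Prod.snd hpq).symm
    have hx' := abs_cdfX_sub_le ν ρ hs p.1
    have hy' := abs_cdfY_sub_le ν ρ hs p.2
    rw [abs_sub_comm] at hx' hy'
    have h2m : (2 : ℝ) / m = 1 / m + 1 / m := by ring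
    rw [Prod.dist_eq, Real.dist_eq, Real.dist_eq]
    refine max_le ?_ ?_
    · change |cdfX ν q.1 - cdfX ρ p.1| ≤ _
      exact (abs_sub_le _ (cdfX ν p.1) _).trans (by linarith)
    · change |cdfY ν q.2 - cdfY ρ p.2| ≤ _
      exact (abs_sub_le _ (cdfY ν p.2) _).trans (by linarith)
  have h3 := (abs_sub_le_iff.1 (abs_measureReal_cell_sub_le ν m ρ U)).1
  calc ρ (cdfPair ρ ⁻¹' B) ≤ ρ (cell ν m ⁻¹' U) := measure_mono hU1
    _ = ENNReal.ofReal (ρ.real (cell ν m ⁻¹' U)) := (ofReal_measureReal).symm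
    _ ≤ ENNReal.ofReal (ν.real (cell ν m ⁻¹' U) + ε.toReal) :=
        ENNReal.ofReal_le_ofReal (by linarith)
    _ = ν (cell ν m ⁻¹' U) + ε := by
        rw [ENNReal.ofReal_add measureReal_nonneg ENNReal.toReal_nonneg, ofReal_measureReal,
          ENNReal.ofReal_toReal hε'.ne]
    _ ≤ _ := by gcongr

end Mesh

lemma strip_real_le {ν : ProbabilityMeasure Ω2} (hν : ν ∈ Mcal) {m : ℕ} (hm : m ≠ 0) (c : Bool)
    (j : ℕ) : (ν : Measure Ω2).real (strip ν m c j) ≤ 1 / m := by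
  have hX : ∀ x, cdfX ν x = ((ν : Measure Ω2).map Prod.fst).real (Set.Iic x) := fun x => by
    rw [map_measureReal_apply measurable_fst measurableSet_Iic]; rfl
  have hY : ∀ x, cdfY ν x = ((ν : Measure Ω2).map Prod.snd).real (Set.Iic x) := fun x => by
    rw [map_measureReal_apply measurable_snd measurableSet_Iic]; rfl
  cases c
  · have : IsProbabilityMeasure ((ν : Measure Ω2).map Prod.fst) :=
      Measure.isProbabilityMeasure_map measurable_fst.aemeasurable
    have h := measureReal_floor_cdf_le _ hν.2.1 hm j
    simp_rw [← hX] at h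
    have hmeas : MeasurableSet {x | ⌊m * cdfX (ν : Measure Ω2) x⌋₊ = j} :=
      (Nat.measurable_floor.comp ((monotone_cdfX (ν : Measure Ω2)).measurable.const_mul _))
        (measurableSet_singleton j)
    rwa [map_measureReal_apply measurable_fst hmeas] at h
  · have : IsProbabilityMeasure ((ν : Measure Ω2).map Prod.snd) :=
      Measure.isProbabilityMeasure_map measurable_snd.aemeasurable
    have h := measureReal_floor_cdf_le _ hν.2.2 hm j
    simp_rw [← hY] at h
    have hmeas : MeasurableSet {x | ⌊m * cdfY (ν : Measure Ω2) x⌋₊ = j} :=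
      (Nat.measurable_floor.comp ((monotone_cdfY (ν : Measure Ω2)).measurable.const_mul _))
        (measurableSet_singleton j)
    rwa [map_measureReal_apply measurable_snd hmeas] at h

/-! ### Exponential moments of the discrepancy -/

/-- The `±1`-valued function on the cells given by a set of cells. -/
def signFun (s : Finset (ℕ × ℕ)) (b : ℕ × ℕ) : ℝ := if b ∈ s then 1 else -1

lemma abs_signFun_le (s : Finset (ℕ × ℕ)) (b : ℕ × ℕ) : |signFun s b| ≤ 1 := by
  unfold signFun; split <;> simp

lemma exists_eq_discr (ν ρ : Measure Ω2) [IsProbabilityMeasure ν] [IsProbabilityMeasure ρ] (m : ℕ) :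
    ∃ s ∈ (Finset.range (m + 1) ×ˢ Finset.range (m + 1)).powerset,
      ∫ p, signFun s (cell ν m p) ∂ρ - ∫ p, signFun s (cell ν m p) ∂ν = discr ν m ρ := by
  classical
  refine ⟨(Finset.range (m + 1) ×ˢ Finset.range (m + 1)).filter
    fun b => ν.real (cell ν m ⁻¹' {b}) ≤ ρ.real (cell ν m ⁻¹' {b}), by simp, ?_⟩
  rw [integral_cell, integral_cell, ← Finset.sum_sub_distrib, discr]
  refine Finset.sum_congr rfl fun b hb => ?_
  rw [← mul_sub]
  by_cases h : ν.real (cell ν m ⁻¹' {b}) ≤ ρ.real (cell ν m ⁻¹' {b})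
  · rw [signFun, if_pos (Finset.mem_filter.2 ⟨hb, h⟩), one_mul, abs_of_nonneg (sub_nonneg.2 h)]
  · simp only [signFun, Finset.mem_filter, h, and_false, if_false, neg_one_mul,
      abs_of_neg (sub_neg.2 (not_le.1 h))]

lemma measurable_integral_emp {E : Type*} [MeasurableSpace E] [MeasurableSingletonClass E] {n : ℕ}
    {f : E → ℝ} (hf : Measurable f) : Measurable fun z : Fin n → E => ∫ x, f x ∂emp z := by
  simp_rw [integral_emp]
  fun_prop

lemma measurable_emp_real {E : Type*} [MeasurableSpace E] [MeasurableSingletonClass E] {n : ℕ}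
    {S : Set E} (hS : MeasurableSet S) : Measurable fun z : Fin n → E => (emp z).real S := by
  have : ∀ z : Fin n → E, (emp z).real S = ∫ x, S.indicator (fun _ => (1 : ℝ)) x ∂emp z :=
    fun z => by rw [emp_real z hS, integral_emp]
  simp_rw [this]
  exact measurable_integral_emp (measurable_const.indicator hS)

lemma exists_moment_bound {ν : ProbabilityMeasure Ω2} (hν : ν ∈ Mcal) {B ε : ℝ} (hB : 0 ≤ B)
    (hε : 0 < ε) : ∃ m₀ : ℕ, ∀ m ≥ m₀, ∃ C : ℝ, 0 ≤ C ∧ ∀ n ≠ 0,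
      ∃ W : (Fin n → Ω2) → ℝ≥0∞, Measurable W ∧
        ∫⁻ z, W z ∂pmeas (ν : Measure Ω2) n ≤ ENNReal.ofReal (C * Real.exp (n * ε)) ∧
        ∀ z, ENNReal.ofReal (Real.exp (n * (discr ν m (emp z) ^ 2 / 32 +
          B * maxStrip ν m (emp z)))) ≤ W z := by
  obtain ⟨J, hJ⟩ := exists_nat_ge (max 1 (1 / ε))
  obtain ⟨m₀, hm₀⟩ := exists_nat_ge (max 1 (Real.exp (2 * B) / ε))
  have hJ1 : (1 : ℝ) ≤ J := (le_max_left _ _).trans hJ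
  have hJ0 : J ≠ 0 := by rintro rfl; norm_num at hJ1
  have hJε : 1 / (16 * (J : ℝ) ^ 2) ≤ ε := by
    have h1 : 1 / ε ≤ J := (le_max_right _ _).trans hJ
    rw [div_le_iff₀ hε] at h1
    rw [div_le_iff₀ (by positivity)]
    nlinarith
  refine ⟨m₀, fun m hm => ?_⟩
  have hmm : (m₀ : ℝ) ≤ m := by exact_mod_cast hm
  have hm1 : (1 : ℝ) ≤ m := (le_max_left _ _).trans (hm₀.trans hmm)
  have hm0 : m ≠ 0 := by rintro rfl; norm_num at hm1
  have hmε : 1 / (m : ℝ) * Real.exp (2 * B) ≤ ε := by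
    have h1 : Real.exp (2 * B) / ε ≤ m := (le_max_right _ _).trans (hm₀.trans hmm)
    rw [div_le_iff₀ hε] at h1
    rw [one_div_mul_eq_div, div_le_iff₀ (by positivity)]
    linarith
  set P := (Finset.range (m + 1) ×ˢ Finset.range (m + 1)).powerset
  refine ⟨P.card * (4 * J + 1 : ℕ) + (Finset.univ : Finset (Bool × Fin (m + 1))).card,
    by positivity, fun n hn => ?_⟩
  have hsf : ∀ s, Measurable fun p => signFun s (cell ν m p) := fun s =>
    (Measurable.of_discrete (f := signFun s)).comp (measurable_cell (ν : Measure Ω2) m)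
  have hst := measurableSet_strip (ν : Measure Ω2) m
  let W₁ : Finset (ℕ × ℕ) → (Fin n → Ω2) → ℝ≥0∞ := fun s z =>
    ENNReal.ofReal (Real.exp (n * ((∫ p, signFun s (cell ν m p) ∂emp z -
      ∫ p, signFun s (cell ν m p) ∂(ν : Measure Ω2)) ^ 2 / 16)))
  let W₂ : Bool × Fin (m + 1) → (Fin n → Ω2) → ℝ≥0∞ := fun q z =>
    ENNReal.ofReal (Real.exp (n * (2 * B * (emp z).real (strip ν m q.1 q.2))))
  have hW₁ : ∀ s, Measurable (W₁ s) := fun s => by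
    have := measurable_integral_emp (n := n) (hsf s)
    fun_prop
  have hW₂ : ∀ q, Measurable (W₂ q) := fun q => by
    have := measurable_emp_real (n := n) (hst q.1 q.2)
    fun_prop
  have hI₁ : ∀ s, ∫⁻ z, W₁ s z ∂pmeas (ν : Measure Ω2) n ≤
      ENNReal.ofReal ((4 * J + 1 : ℕ) * Real.exp (n * ε)) := fun s => by
    refine (lintegral_exp_sq_le (hsf s) (fun _ => abs_signFun_le s _) hJ0 hn).trans ?_
    rw [ENNReal.ofReal_mul (by positivity), ENNReal.ofReal_natCast]
    gcongr
  have hI₂ : ∀ q, ∫⁻ z, W₂ q z ∂pmeas (ν : Measure Ω2) n ≤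
      ENNReal.ofReal (Real.exp (n * ε)) := fun q => by
    refine (lintegral_exp_indicator_le (hst q.1 q.2) (strip_real_le hν hm0 q.1 q.2)
      (by positivity) hn).trans ?_
    gcongr
  refine ⟨fun z => ∑ s ∈ P, W₁ s z + ∑ q, W₂ q z, by fun_prop, ?_, fun z => ?_⟩
  · rw [lintegral_add_left (by fun_prop), lintegral_finsetSum _ fun s _ => hW₁ s,
      lintegral_finsetSum _ fun q _ => hW₂ q]
    calc _ ≤ ∑ s ∈ P, ENNReal.ofReal ((4 * J + 1 : ℕ) * Real.exp (n * ε)) +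
          ∑ q : Bool × Fin (m + 1), ENNReal.ofReal (Real.exp (n * ε)) :=
        add_le_add (Finset.sum_le_sum fun s _ => hI₁ s) (Finset.sum_le_sum fun q _ => hI₂ q)
      _ = _ := by
        rw [Finset.sum_const, Finset.sum_const, nsmul_eq_mul, nsmul_eq_mul,
          ← ENNReal.ofReal_natCast, ← ENNReal.ofReal_natCast, ← ENNReal.ofReal_mul (by positivity),
          ← ENNReal.ofReal_mul (by positivity), ← ENNReal.ofReal_add (by positivity)
          (by positivity)]
        congr 1; ring
  · have := isProbabilityMeasure_emp hn z
    obtain ⟨s, hs, hsd⟩ := exists_eq_discr (ν : Measure Ω2) (emp z) m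
    obtain ⟨q, hq⟩ := exists_eq_maxStrip (ν : Measure Ω2) m (emp z)
    have hexp : ∀ x y : ℝ, Real.exp (x + y) ≤ Real.exp (2 * x) + Real.exp (2 * y) := fun x y => by
      rw [Real.exp_add, two_mul, two_mul, Real.exp_add, Real.exp_add]
      nlinarith [sq_nonneg (Real.exp x - Real.exp y), Real.exp_pos x, Real.exp_pos y]
    calc _ ≤ ENNReal.ofReal (Real.exp (2 * (n * (discr ν m (emp z) ^ 2 / 32))) +
          Real.exp (2 * (n * (B * maxStrip ν m (emp z))))) := by
          rw [mul_add]; exact ENNReal.ofReal_le_ofReal (hexp _ _)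
      _ = W₁ s z + W₂ q z := by
          rw [ENNReal.ofReal_add (Real.exp_pos _).le (Real.exp_pos _).le]
          simp only [W₁, W₂, hsd, hq]
          congr 3 <;> ring_nf
      _ ≤ _ := add_le_add (Finset.single_le_sum (f := fun s => W₁ s z) (fun _ _ => zero_le) hs)
          (Finset.single_le_sum (f := fun q => W₂ q z) (fun _ _ => zero_le) (Finset.mem_univ q))

/-! ### Large deviation bounds -/

section Deviation

variable {k : ℕ} {σ : Equiv.Perm (Fin (k + 1))} {μ ν : ProbabilityMeasure Ω2} {θ : ℝ} {u : Ω2 → ℝ}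

lemma ofReal_exp_sum_eq {n : ℕ} (z : Fin n → Ω2) (hn : n ≠ 0) (u : Ω2 → ℝ) :
    ∏ i, ENNReal.ofReal (Real.exp (u (z i))) =
      ENNReal.ofReal (Real.exp (n * ∫ x, u x ∂emp z)) := by
  have hn' : (n : ℝ) ≠ 0 := by exact_mod_cast hn
  rw [integral_emp, mul_inv_cancel_left₀ hn', Real.exp_sum,
    ENNReal.ofReal_prod_of_nonneg fun i _ => (Real.exp_pos _).le]

lemma IsGibbs.pmeas_eq (h : IsGibbs σ μ θ ν u) {n : ℕ} (hn : n ≠ 0) :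
    pmeas (ν : Measure Ω2) n = (pmeas (μ : Measure Ω2) n).withDensity fun z =>
      ENNReal.ofReal (Real.exp (n * ∫ x, u x ∂emp z)) := by
  have := pi_withDensity (μ : Measure Ω2) (ν : Measure Ω2)
    (ENNReal.measurable_ofReal.comp (Real.measurable_exp.comp h.measurable)) h.dens n
  refine this.trans ?_
  simp only [Function.comp_apply, ofReal_exp_sum_eq _ hn]
  rfl

lemma IsGibbs.pmeas_le (h : IsGibbs σ μ θ ν u) {n : ℕ} (hn : n ≠ 0) {W : (Fin n → Ω2) → ℝ≥0∞}
    (hW : Measurable W) {a : ℝ} {S : Set (Fin n → Ω2)} (hS : ∀ z ∈ S, ENNReal.ofReal (Real.exp a) ≤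
      ENNReal.ofReal (Real.exp (n * ∫ x, u x ∂emp z)) * W z) :
    pmeas (μ : Measure Ω2) n S ≤
      ENNReal.ofReal (Real.exp (-a)) * ∫⁻ z, W z ∂pmeas (ν : Measure Ω2) n := by
  have hm : Measurable fun z : Fin n → Ω2 =>
      ENNReal.ofReal (Real.exp (n * ∫ x, u x ∂emp z)) := by
    have := measurable_integral_emp (n := n) h.measurable
    fun_prop
  rw [h.pmeas_eq hn, lintegral_withDensity_eq_lintegral_mul _ hm hW]
  have h1 := mul_meas_ge_le_lintegral (μ := pmeas (μ : Measure Ω2) n) (hm.mul hW)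
    (ENNReal.ofReal (Real.exp a))
  calc pmeas (μ : Measure Ω2) n S = ENNReal.ofReal (Real.exp (-a)) *
        (ENNReal.ofReal (Real.exp a) * pmeas (μ : Measure Ω2) n S) := by
        rw [← mul_assoc, ← ENNReal.ofReal_mul (Real.exp_pos _).le, ← Real.exp_add]; simp
    _ ≤ _ := by
        gcongr
        refine le_trans ?_ h1
        gcongr
        exact hS

lemma IsGibbs.integral_sub_eq (h : IsGibbs σ μ θ ν u) (ρ : Measure Ω2) [IsProbabilityMeasure ρ] :
    ∫ x, u x ∂ρ - ∫ x, u x ∂(ν : Measure Ω2) = θ * (k + 1) *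
      (∫ x, hCond σ ν x ∂ρ - tPat σ ν) := by
  obtain ⟨c, hc⟩ := h.pot
  rw [h.integral_eq hc, h.integral_eq hc, tPat_eq_integral_hCond]
  ring

lemma exists_nat_div_le (a : ℝ) {b : ℝ} (hb : 0 < b) :
    ∃ m₀ : ℕ, ∀ m ≥ m₀, m ≠ 0 → a / m ≤ b := by
  obtain ⟨m₀, h⟩ := exists_nat_ge (a / b)
  refine ⟨m₀, fun m hm h0 => ?_⟩
  have h1 : (m₀ : ℝ) ≤ m := by exact_mod_cast hm
  rw [div_le_iff₀ hb] at h
  rw [div_le_iff₀ (by positivity)]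
  nlinarith

lemma IsGibbs.upper_bound (hν : ν ∈ Mcal) (h : IsGibbs σ μ θ ν u) (h0 : 0 ≤ θ)
    (hθ : θ * (k + 1) ^ 2 ≤ 1 / 100) {ε : ℝ} (hε : 0 < ε) :
    ∃ η > (0 : ℝ), ∃ C : ℝ, 0 ≤ C ∧ ∀ n ≠ 0,
      pmeas (μ : Measure Ω2) n {z | ENNReal.ofReal ε ≤ dLPE (Omap (emp z)) (Omap ν) ∧
        tPat σ ν ≤ tPat σ (emp z)} ≤
      ENNReal.ofReal (C * Real.exp (-(n * (∫ x, u x ∂(ν : Measure Ω2) + η)))) := by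
  set B : ℝ := θ * (8 * (k + 1) ^ 3) with hBdef
  have hB : 0 ≤ B := by positivity
  set e : ℝ := (ε / 2) ^ 2 / 200 with he
  have he0 : 0 < e := by positivity
  obtain ⟨m₁, hm₁⟩ := exists_moment_bound hν hB he0
  obtain ⟨m₂, hm₂⟩ := exists_nat_div_le B he0
  obtain ⟨m₃, hm₃⟩ := exists_nat_div_le 2 (half_pos hε)
  set m := m₁ + m₂ + m₃ + 1
  have hm0 : m ≠ 0 := by omega
  obtain ⟨C, hC, hW⟩ := hm₁ m (by omega)
  have hBm := hm₂ m (by omega) hm0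
  have h2m := hm₃ m (by omega) hm0
  have hstrip := strip_real_le hν hm0
  refine ⟨e, he0, C, hC, fun n hn => ?_⟩
  obtain ⟨W, hWm, hWI, hWle⟩ := hW n hn
  set D := ∫ x, u x ∂(ν : Measure Ω2) with hD
  refine (h.pmeas_le hn hWm (a := n * (D + 2 * e)) fun z hz => ?_).trans ?_
  · have := isProbabilityMeasure_emp hn z
    refine le_trans ?_ (mul_le_mul_right (hWle z) _)
    rw [← ENNReal.ofReal_mul (Real.exp_pos _).le, ← Real.exp_add, ← mul_add]
    refine ENNReal.ofReal_le_ofReal (Real.exp_le_exp.2 (mul_le_mul_of_nonneg_left ?_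
      (Nat.cast_nonneg n)))
    have hd0 := discr_nonneg (ν : Measure Ω2) m (emp z)
    have hdisc : ε / 2 ≤ discr ν m (emp z) := by
      have h1 := hz.1.trans (dLPE_Omap_le (ν : Measure Ω2) (emp z) hm0 hstrip)
      rw [ENNReal.ofReal_le_ofReal_iff (by positivity)] at h1
      linarith
    have hrem := (abs_le.1 (abs_tRem_le_of_strip (ν : Measure Ω2) m σ (emp z) hstrip)).2
    have hid := h.integral_sub_eq (emp z)
    have hrem' := mul_le_mul_of_nonneg_left hrem h0
    have hid' : ∫ x, u x ∂emp z = D + θ * (tPat σ (emp z) - tPat σ ν) - θ * tRem σ ν (emp z) := by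
      rw [tRem, tPat_eq_integral_hCond, ← tPat_eq_integral_hCond]
      linear_combination hid
    have ht := mul_nonneg h0 (sub_nonneg.2 hz.2)
    have hsq : (ε / 2) ^ 2 ≤ discr ν m (emp z) ^ 2 := by gcongr
    have h3 : θ * (k + 1) ^ 2 * discr ν m (emp z) ^ 2 ≤ 1 / 100 * discr ν m (emp z) ^ 2 := by
      gcongr
    have h4 : θ * ((k + 1) ^ 2 * discr ν m (emp z) ^ 2 +
        8 * (k + 1) ^ 3 * (maxStrip ν m (emp z) + 1 / m)) =
        θ * (k + 1) ^ 2 * discr ν m (emp z) ^ 2 + B * maxStrip ν m (emp z) + B / m := by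
      rw [hBdef]; ring
    rw [hid']
    linarith
  · calc _ ≤ ENNReal.ofReal (Real.exp (-(n * (D + 2 * e)))) *
          ENNReal.ofReal (C * Real.exp (n * e)) := by gcongr
      _ = _ := by
          rw [← ENNReal.ofReal_mul (Real.exp_pos _).le, mul_left_comm, ← Real.exp_add]
          congr 3; ring

lemma exists_forall_measure_le (ν : Measure Ω2) (C : ℝ) {ε c : ℝ} (h : ε < c) :
    ∃ N : ℕ, ∀ n ≥ N, ∀ W : (Fin n → Ω2) → ℝ≥0∞, Measurable W →
      ∫⁻ z, W z ∂pmeas ν n ≤ ENNReal.ofReal (C * Real.exp (n * ε)) →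
      pmeas ν n {z | ENNReal.ofReal (Real.exp (n * c)) ≤ W z} ≤ ENNReal.ofReal (1 / 4) := by
  have ht : Tendsto (fun n : ℕ => C * Real.exp (-((c - ε) * n))) atTop (𝓝 (C * 0)) :=
    ((Real.tendsto_exp_neg_atTop_nhds_zero.comp
      (tendsto_natCast_atTop_atTop.const_mul_atTop (sub_pos.2 h)))).const_mul C
  rw [mul_zero] at ht
  obtain ⟨N, hN⟩ := eventually_atTop.1 (ht.eventually (gt_mem_nhds (by norm_num : (0 : ℝ) < 1 / 4)))
  refine ⟨N, fun n hn W hW hI => ?_⟩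
  have h1 := (mul_meas_ge_le_lintegral (μ := pmeas ν n) hW
    (ENNReal.ofReal (Real.exp (n * c)))).trans hI
  calc _ = ENNReal.ofReal (Real.exp (-(n * c))) * (ENNReal.ofReal (Real.exp (n * c)) *
        pmeas ν n {z | ENNReal.ofReal (Real.exp (n * c)) ≤ W z}) := by
        rw [← mul_assoc, ← ENNReal.ofReal_mul (Real.exp_pos _).le, ← Real.exp_add]; simp
    _ ≤ ENNReal.ofReal (Real.exp (-(n * c))) * ENNReal.ofReal (C * Real.exp (n * ε)) := by gcongr
    _ = ENNReal.ofReal (C * Real.exp (-((c - ε) * n))) := by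
        rw [← ENNReal.ofReal_mul (Real.exp_pos _).le, mul_left_comm, ← Real.exp_add]
        congr 3; ring
    _ ≤ _ := ENNReal.ofReal_le_ofReal (hN n hn).le

lemma IsGibbs.lower_bound (hν : ν ∈ Mcal) (h : IsGibbs σ μ θ ν u)
    (hθ : |θ| * (k + 1) ^ 2 ≤ 1 / 100) {δ η : ℝ} (hδ : δ < tPat σ ν) (hη : 0 < η) :
    ∃ N : ℕ, ∀ n ≥ N,
      ENNReal.ofReal (1 / 2 * Real.exp (-(n * (∫ x, u x ∂(ν : Measure Ω2) + η)))) ≤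
        pmeas (μ : Measure Ω2) n {z | δ ≤ tPat σ (emp z)} := by
  have hKpos : (0 : ℝ) < k + 1 := by positivity
  have hK1 : (1 : ℝ) ≤ k + 1 := by linarith [Nat.cast_nonneg (α := ℝ) k]
  have hθ1 : |θ| ≤ 1 := by nlinarith [abs_nonneg θ]
  set g := tPat σ ν - δ with hg
  have hg0 : 0 < g := sub_pos.2 hδ
  set K : ℝ := (k : ℝ) + 1 with hK
  set s : ℝ := min (g / 4) η / K with hs
  have hs0 : 0 < s := by positivity
  have hKs : K * s = min (g / 4) η := by rw [hs]; field_simp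
  set c : ℝ := g / (160 * K ^ 3) with hc
  have hc0 : 0 < c := by positivity
  obtain ⟨m₁, hm₁⟩ := exists_moment_bound hν (B := 1) zero_le_one (half_pos hc0)
  obtain ⟨m₂, hm₂⟩ := exists_nat_div_le (8 * K ^ 3) (b := g / 4) (by positivity)
  set m := m₁ + m₂ + 1
  have hm0 : m ≠ 0 := by omega
  obtain ⟨C, hC, hW⟩ := hm₁ m (by omega)
  have hKm := hm₂ m (by omega) hm0
  obtain ⟨J, hJ⟩ := exists_nat_ge (max 1 (2 / s ^ 2))
  have hJ1 : (1 : ℝ) ≤ J := (le_max_left _ _).trans hJ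
  have hJ0 : J ≠ 0 := by rintro rfl; norm_num at hJ1
  have hJs : 1 / (16 * (J : ℝ) ^ 2) < s ^ 2 / 16 := by
    have h1 : 2 / s ^ 2 ≤ J := (le_max_right _ _).trans hJ
    have hss : 0 < s ^ 2 := by positivity
    rw [div_le_iff₀ hss] at h1
    rw [div_lt_iff₀ (by positivity)]
    nlinarith [mul_nonneg (sub_nonneg.2 hJ1) hss.le, sq_nonneg ((J : ℝ) - 1)]
  obtain ⟨N₁, hN₁⟩ := exists_forall_measure_le (ν : Measure Ω2) C (half_lt_self hc0)
  obtain ⟨N₂, hN₂⟩ := exists_forall_measure_le (ν : Measure Ω2) (4 * J + 1 : ℕ) hJs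
  refine ⟨N₁ + N₂ + 1, fun n hn => ?_⟩
  have hn0 : n ≠ 0 := by omega
  have hn0' : (0 : ℝ) < n := by positivity
  obtain ⟨W, hWm, hWI, hWle⟩ := hW n hn0
  have hP₁ := hN₁ n (by omega) W hWm hWI
  have hhm := measurable_hCond σ (ν : Measure Ω2)
  have hXm := measurable_integral_emp (n := n) hhm
  let V : (Fin n → Ω2) → ℝ≥0∞ := fun z => ENNReal.ofReal (Real.exp
    (n * ((∫ x, hCond σ ν x ∂emp z - ∫ x, hCond σ ν x ∂(ν : Measure Ω2)) ^ 2 / 16)))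
  have hVm : Measurable V := by fun_prop
  have hP₂ := hN₂ n (by omega) V hVm (by
    refine (lintegral_exp_sq_le hhm (hCond_abs_le σ _) hJ0 hn0).trans ?_
    rw [ENNReal.ofReal_mul (by positivity), ENNReal.ofReal_natCast])
  set A : Set (Fin n → Ω2) := {z | ENNReal.ofReal (Real.exp (n * c)) ≤ W z} ∪
    {z | ENNReal.ofReal (Real.exp (n * (s ^ 2 / 16))) ≤ V z} with hA
  have hAm : MeasurableSet A :=
    (measurableSet_le measurable_const hWm).union (measurableSet_le measurable_const hVm)
  have hAle : pmeas (ν : Measure Ω2) n A ≤ ENNReal.ofReal (1 / 2) := by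
    refine (measure_union_le _ _).trans ((add_le_add hP₁ hP₂).trans ?_)
    rw [← ENNReal.ofReal_add (by norm_num) (by norm_num)]
    norm_num
  have hAc : ENNReal.ofReal (1 / 2) ≤ pmeas (ν : Measure Ω2) n Aᶜ := by
    rw [prob_compl_eq_one_sub hAm]
    refine le_trans (le_of_eq ?_) (tsub_le_tsub_left hAle 1)
    rw [← ENNReal.ofReal_one, ← ENNReal.ofReal_sub _ (by norm_num)]
    norm_num
  set D := ∫ x, u x ∂(ν : Measure Ω2) with hD
  have hgood : ∀ z ∈ Aᶜ, δ ≤ tPat σ (emp z) ∧ ∫ x, u x ∂emp z ≤ D + η := by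
    intro z hz
    have := isProbabilityMeasure_emp hn0 z
    simp only [hA, Set.mem_compl_iff, Set.mem_union, Set.mem_ofPred_eq, not_or, not_le] at hz
    have hz1 := (hWle z).trans_lt hz.1
    have hz2 := hz.2
    simp only [V] at hz2
    rw [ENNReal.ofReal_lt_ofReal_iff (Real.exp_pos _), Real.exp_lt_exp,
      mul_lt_mul_iff_right₀ hn0'] at hz1 hz2
    set X := ∫ x, hCond σ ν x ∂emp z - ∫ x, hCond σ ν x ∂(ν : Measure Ω2) with hX
    have hXs : |X| ≤ s := by
      refine abs_le_of_sq_le_sq ?_ hs0.le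
      linarith
    have hKX : |K * X| ≤ min (g / 4) η := by
      rw [abs_mul, abs_of_pos hKpos, ← hKs]
      gcongr
    have hmax0 := maxStrip_nonneg (ν : Measure Ω2) m (emp z)
    have hrem := (abs_le.1 (abs_tRem_le_of_strip (ν : Measure Ω2) m σ (emp z)
      (strip_real_le hν hm0))).1
    rw [← hK] at hrem
    have hremeq : tRem σ ν (emp z) = tPat σ (emp z) - tPat σ ν - K * X := by
      rw [tRem, hX, ← tPat_eq_integral_hCond]
    have hd2 : discr ν m (emp z) ^ 2 ≤ 32 * c := by linarith
    have hmx : maxStrip ν m (emp z) ≤ c := by linarith [sq_nonneg (discr ν m (emp z))]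
    have hK3 : K ^ 2 ≤ K ^ 3 := pow_le_pow_right₀ hK1 (by norm_num)
    have h1 : K ^ 2 * discr ν m (emp z) ^ 2 + 8 * K ^ 3 * (maxStrip ν m (emp z) + 1 / m) ≤
        K ^ 3 * (32 * c) + 8 * K ^ 3 * c + 8 * K ^ 3 / m := by
      have h2 : K ^ 2 * discr ν m (emp z) ^ 2 ≤ K ^ 3 * (32 * c) := by gcongr
      have h3 : 8 * K ^ 3 * maxStrip ν m (emp z) ≤ 8 * K ^ 3 * c := by gcongr
      have h4 : 8 * K ^ 3 * (maxStrip ν m (emp z) + 1 / m) =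
        8 * K ^ 3 * maxStrip ν m (emp z) + 8 * K ^ 3 / m := by ring
      linarith
    have h5 : K ^ 3 * (32 * c) + 8 * K ^ 3 * c = g / 4 := by rw [hc]; field_simp; norm_num
    have hKX1 := (abs_le.1 (hKX.trans (min_le_left _ _))).1
    refine ⟨by linarith, ?_⟩
    have hid := h.integral_sub_eq (emp z)
    rw [tPat_eq_integral_hCond, ← hX, ← hK, ← hD, mul_assoc] at hid
    have h6 : θ * (K * X) ≤ η := by
      refine (le_abs_self _).trans ?_
      rw [abs_mul]
      exact (mul_le_of_le_one_left (abs_nonneg _) hθ1).trans (hKX.trans (min_le_right _ _))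
    linarith
  have hfin : pmeas (ν : Measure Ω2) n Aᶜ ≤ ENNReal.ofReal (Real.exp (n * (D + η))) *
      pmeas (μ : Measure Ω2) n Aᶜ := by
    rw [h.pmeas_eq hn0, withDensity_apply _ hAm.compl, ← setLIntegral_const]
    refine setLIntegral_mono measurable_const fun z hz => ?_
    gcongr
    exact (hgood z hz).2
  calc _ = ENNReal.ofReal (Real.exp (-(n * (D + η)))) * ENNReal.ofReal (1 / 2) := by
        rw [mul_comm, ENNReal.ofReal_mul (Real.exp_pos _).le]
    _ ≤ ENNReal.ofReal (Real.exp (-(n * (D + η)))) * (ENNReal.ofReal (Real.exp (n * (D + η))) *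
          pmeas (μ : Measure Ω2) n Aᶜ) := by
        gcongr
        exact hAc.trans hfin
    _ = pmeas (μ : Measure Ω2) n Aᶜ := by
        rw [← mul_assoc, ← ENNReal.ofReal_mul (Real.exp_pos _).le, ← Real.exp_add]; simp
    _ ≤ _ := measure_mono fun z hz => (hgood z hz).1

lemma IsGibbs.tendsto_conditioned (hμ : μ ∈ Mcal)
    (h : IsGibbs σ μ θ ν u) (h0 : 0 ≤ θ)
    (hθ : θ * (k + 1) ^ 2 ≤ 1 / 100) {ε : ℝ} (hε : 0 < ε)
    (hex : ∀ η > (0 : ℝ), ∃ θ' u', ∃ ν' : ProbabilityMeasure Ω2, IsGibbs σ μ θ' ν' u' ∧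
      |θ'| * (k + 1) ^ 2 ≤ 1 / 100 ∧ tPat σ ν < tPat σ ν' ∧
      ∫ x, u' x ∂(ν' : Measure Ω2) ≤ ∫ x, u x ∂(ν : Measure Ω2) + η) :
    Tendsto (fun n : ℕ =>
      pmeas (μ : Measure Ω2) n {z | ENNReal.ofReal ε ≤ dLPE (EmM (inducedPerm z)) (Omap ν) ∧
        tPat σ ν ≤ tPerm σ (inducedPerm z)} /
      pmeas (μ : Measure Ω2) n {z | tPat σ ν ≤ tPerm σ (inducedPerm z)}) atTop (𝓝 0) := by
  have hν := mem_Mcal_of_absolutelyContinuous hμ h.absolutelyContinuous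
  obtain ⟨η, hη, C, hC, hup⟩ := h.upper_bound hν h0 hθ hε
  obtain ⟨θ', u', ν', h', hθ', ht', hD'⟩ := hex (η / 4) (by positivity)
  obtain ⟨N, hlow⟩ := h'.lower_bound (mem_Mcal_of_absolutelyContinuous hμ h'.absolutelyContinuous)
    hθ' ht' (η := η / 4) (by positivity)
  have hlim : Tendsto (fun n : ℕ => ENNReal.ofReal (2 * C * Real.exp (-(η / 2 * n)))) atTop
      (𝓝 0) := by
    have := ((Real.tendsto_exp_neg_atTop_nhds_zero.comp
      (tendsto_natCast_atTop_atTop.const_mul_atTop (half_pos hη)))).const_mul (2 * C)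
    simpa using ENNReal.tendsto_ofReal this
  refine tendsto_of_tendsto_of_tendsto_of_le_of_le' tendsto_const_nhds hlim
    (Eventually.of_forall fun _ => zero_le) ?_
  filter_upwards [eventually_ge_atTop (N + 1)] with n hn
  have hn0 : n ≠ 0 := by omega
  have e1 : pmeas (μ : Measure Ω2) n {z | ENNReal.ofReal ε ≤ dLPE (EmM (inducedPerm z)) (Omap ν) ∧
      tPat σ ν ≤ tPerm σ (inducedPerm z)} = pmeas (μ : Measure Ω2) n
      {z | ENNReal.ofReal ε ≤ dLPE (Omap (emp z)) (Omap ν) ∧ tPat σ ν ≤ tPat σ (emp z)} := by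
    refine measure_congr ?_
    filter_upwards [ae_generic hμ n] with z hz
    refine propext (Iff.of_eq ?_)
    change (_ ∧ _) = (_ ∧ _)
    rw [tPerm_inducedPerm σ hz hn0, EmM_inducedPerm hz hn0]
    rfl
  have e2 : pmeas (μ : Measure Ω2) n {z | tPat σ ν ≤ tPerm σ (inducedPerm z)} =
      pmeas (μ : Measure Ω2) n {z | tPat σ ν ≤ tPat σ (emp z)} := by
    refine measure_congr ?_
    filter_upwards [ae_generic hμ n] with z hz
    change (_ ≤ _) = (_ ≤ _)
    rw [tPerm_inducedPerm σ hz hn0]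
  rw [e1, e2]
  refine ENNReal.div_le_of_le_mul ((hup n hn0).trans ?_)
  refine le_trans ?_ (mul_le_mul_right (hlow n (by omega)) _)
  rw [← ENNReal.ofReal_mul (by positivity)]
  refine ENNReal.ofReal_le_ofReal ?_
  have : 2 * C * Real.exp (-(η / 2 * n)) *
      (1 / 2 * Real.exp (-(n * (∫ x, u' x ∂(ν' : Measure Ω2) + η / 4)))) =
      C * Real.exp (-(η / 2 * n) + -(n * (∫ x, u' x ∂(ν' : Measure Ω2) + η / 4))) := by
    rw [Real.exp_add]; ring
  rw [this]
  refine mul_le_mul_of_nonneg_left (Real.exp_le_exp.2 ?_) hC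
  nlinarith [mul_le_mul_of_nonneg_left hD' (Nat.cast_nonneg (α := ℝ) n)]

end Deviation

lemma continuousOn_Gfun_of_forall_exists {k : ℕ} {σ : Equiv.Perm (Fin (k + 1))}
    {μ : ProbabilityMeasure Ω2} (hμ : μ ∈ Mcal) {θc : ℝ} (hθc : 0 ≤ θc)
    (hθcK : θc * (k + 1) ^ 2 ≤ 1 / 100) {s : Set ℝ}
    (hs : ∀ δ ∈ s, ∃ θ ∈ Set.Ioo 0 θc, ∃ ν : ProbabilityMeasure Ω2, ∃ u,
      IsGibbs σ μ θ ν u ∧ tPat σ (ν : Measure Ω2) = δ) :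
    ContinuousOn (Gfun σ (μ : Measure Ω2)) s := by
  have hθK : ∀ θ ∈ Set.Ioo 0 θc, |θ| * (k + 1) ^ 2 ≤ 1 / 100 := fun θ hθ => by
    rw [abs_of_pos hθ.1]
    exact le_trans (by have := hθ.2.le; gcongr) hθcK
  have hG : ∀ δ ∈ s, ENNReal.ofReal (Gfun σ (μ : Measure Ω2) δ).toReal =
      Gfun σ (μ : Measure Ω2) δ := by
    intro δ hδ
    obtain ⟨θ, hθ, ν, u, h, rfl⟩ := hs δ hδ
    rw [(Gset_eq_singleton hμ h (hθK θ hθ) hθ.1).1, ENNReal.ofReal_toReal h.KL_ne_top]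
  have hlip : LipschitzOnWith θc.toNNReal (fun δ => (Gfun σ (μ : Measure Ω2) δ).toReal) s := by
    refine LipschitzOnWith.of_le_add_mul _ fun δ hδ δ' hδ' => ?_
    obtain ⟨θ, hθ, ν, u, h, rfl⟩ := hs δ hδ
    obtain ⟨θ', hθ', ν', u', h', rfl⟩ := hs δ' hδ'
    have h1 := le_Gfun_toReal h (hθK θ hθ) h'.KL_ne_top
    rw [(Gset_eq_singleton hμ h (hθK θ hθ) hθ.1).1, (Gset_eq_singleton hμ h' (hθK θ' hθ') hθ'.1).1,
      Real.coe_toNNReal _ hθc, Real.dist_eq]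
    have h2 : θ * (tPat σ (ν : Measure Ω2) - tPat σ (ν' : Measure Ω2)) ≤
        θc * |tPat σ (ν : Measure Ω2) - tPat σ (ν' : Measure Ω2)| :=
      (mul_le_mul_of_nonneg_left (le_abs_self _) hθ.1.le).trans
        (mul_le_mul_of_nonneg_right hθ.2.le (abs_nonneg _))
    linarith
  exact (ENNReal.continuous_ofReal.comp_continuousOn hlip.continuousOn).congr fun δ hδ =>
    (hG δ hδ).symm

/-- Theorem 1.14 (ii): for `μ ∈ ℳ` CNC w.r.t. a pattern `σ` of size
`k+1`, with `θ_c` depending only on `k`, unique maximizers `ν_θ` for `θ ∈ (−θ_c,θ_c)`, and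
`δ_c := sup_θ t_σ(ν_θ)`: `δ_c > t_σ(μ)` and for every `δ ∈ (t_σ(μ),δ_c)` the conclusions
(a)–(d) hold. -/
theorem conditioned_cnc (k : ℕ) :
    ∃ θc > (0 : ℝ), ∀ (σ : Equiv.Perm (Fin (k + 1))) (μ : ProbabilityMeasure Ω2), μ ∈ Mcal →
      ¬ IsCC σ (↑μ) →
      ∃ ν : ℝ → ProbabilityMeasure Ω2,
        (∀ θ ∈ Set.Ioo (-θc) θc, Fset σ (↑μ) θ = {ν θ}) ∧
        tPat σ ((↑μ : Measure Ω2)) <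
          sSup ((fun θ => tPat σ ((ν θ : Measure Ω2))) '' Set.Ioo (-θc) θc) ∧
        (∀ δ ∈ Set.Ioo (tPat σ ((↑μ : Measure Ω2)))
            (sSup ((fun θ => tPat σ ((ν θ : Measure Ω2))) '' Set.Ioo (-θc) θc)),
          ∃ θhat : ℝ,
            IsGreatest {θ : ℝ | θ ∈ Set.Ioo 0 θc ∧ tPat σ ((ν θ : Measure Ω2)) = δ} θhat ∧
            θhat ∈ Set.Ioo 0 θc ∧
            tPat σ ((ν θhat : Measure Ω2)) = δ ∧
            Gset σ (↑μ) δ = {ν θhat} ∧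
            ∀ ε > (0 : ℝ),
              Tendsto (fun n : ℕ =>
                  pmeas (↑μ) n {z | ENNReal.ofReal ε ≤
                      dLPE (EmM (inducedPerm z)) (Omap ↑(ν θhat)) ∧
                      δ ≤ tPerm σ (inducedPerm z)} /
                    pmeas (↑μ) n {z | δ ≤ tPerm σ (inducedPerm z)})
                atTop (𝓝 0)) ∧
        ContinuousOn (Gfun σ ((↑μ : Measure Ω2)))
          (Set.Ioo (tPat σ ((↑μ : Measure Ω2)))
            (sSup ((fun θ => tPat σ ((ν θ : Measure Ω2))) '' Set.Ioo (-θc) θc))) := by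
  set K : ℝ := (k : ℝ) + 1 with hK
  have hKpos : 0 < K := by positivity
  set θc : ℝ := 1 / (100 * K ^ 2) with hθc
  have hθc0 : 0 < θc := by positivity
  have hθcK : θc * K ^ 2 = 1 / 100 := by rw [hθc]; field_simp
  have hθK : ∀ θ ∈ Set.Ioo (-θc) θc, |θ| * K ^ 2 ≤ 1 / 100 := fun θ hθ => by
    have := (abs_lt.2 hθ).le
    rw [← hθcK]
    gcongr
  have hpos : ∀ θ ∈ Set.Ioo 0 θc, θ ∈ Set.Ioo (-θc) θc := fun θ hθ => ⟨by linarith [hθ.1], hθ.2⟩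
  refine ⟨θc, hθc0, fun σ μ hμ hcc => ?_⟩
  have hchoice : ∀ θ : ℝ, ∃ ν : ProbabilityMeasure Ω2, ∃ u : Ω2 → ℝ,
      θ ∈ Set.Ioo (-θc) θc → IsGibbs σ μ θ ν u := by
    intro θ
    by_cases hθ : θ ∈ Set.Ioo (-θc) θc
    · obtain ⟨ν, u, h⟩ := exists_isGibbs σ (μ : Measure Ω2) (hθK θ hθ)
      exact ⟨⟨ν, h.prob⟩, u, fun _ => h⟩
    · exact ⟨μ, 0, fun h => absurd h hθ⟩
  choose ν u hG using hchoice
  set t : ℝ → ℝ := fun θ => tPat σ (ν θ : Measure Ω2) with ht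
  have h0mem : (0 : ℝ) ∈ Set.Ioo (-θc) θc := ⟨by linarith, hθc0⟩
  have ht0 : t 0 = tPat σ (μ : Measure Ω2) := (hG 0 h0mem).tPat_eq_of_zero
  have hvar : ∀ θ ∈ Set.Ioo (-θc) θc, ∀ θ' ∈ Set.Ioo (-θc) θc,
      θ * t θ' - (KL (ν θ') μ).toReal + 1 / (8 * K ^ 2) * (t θ' - t θ) ^ 2 ≤
        θ * t θ - (KL (ν θ) μ).toReal := fun θ hθ θ' hθ' => by
    rw [one_div_mul_eq_div]
    exact (hG θ hθ).sq_le (hθK θ hθ) (ν θ') (hG θ' hθ').KL_ne_top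
  have hc : 0 < 1 / (8 * K ^ 2) := by positivity
  have hgreat : ∀ δ ∈ Set.Ioo (tPat σ (μ : Measure Ω2)) (sSup (t '' Set.Ioo (-θc) θc)),
      ∃ a, IsGreatest {θ | θ ∈ Set.Ioo 0 θc ∧ t θ = δ} a ∧ ∀ θ ∈ Set.Ioo a θc, δ < t θ :=
    fun δ hδ => exists_isGreatest_of_variational (D := fun θ => (KL (ν θ) μ).toReal) hc hvar hθc0
      (by rwa [ht0])
  refine ⟨ν, fun θ hθ => Fset_eq_singleton hμ (hG θ hθ) (hθK θ hθ), ?_, fun δ hδ => ?_, ?_⟩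
  · have hmem : θc / 2 ∈ Set.Ioo (-θc) θc := ⟨by linarith, by linarith⟩
    refine ((hG _ hmem).tPat_lt (hθK _ hmem) (by positivity) hcc).trans_le
      (le_csSup ⟨1, ?_⟩ ⟨_, hmem, rfl⟩)
    rintro _ ⟨θ, -, rfl⟩
    exact tPat_le_one σ _
  · obtain ⟨a, ha, hgt⟩ := hgreat δ hδ
    have ham := hpos a ha.1.1
    have haδ : tPat σ (ν a : Measure Ω2) = δ := ha.1.2
    refine ⟨a, ha, ha.1.1, haδ, ?_, fun ε hε => ?_⟩
    · rw [← haδ]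
      exact (Gset_eq_singleton hμ (hG a ham) (hθK a ham) ha.1.1.1).2
    · rw [← haδ]
      refine (hG a ham).tendsto_conditioned hμ ha.1.1.1.le
        (by rw [← abs_of_pos ha.1.1.1]; exact hθK a ham) hε fun η hη => ?_
      have hKL : ∀ θ ∈ Set.Ioo (-θc) θc, (KL (ν θ) μ).toReal = ∫ x, u θ x ∂(ν θ : Measure Ω2) :=
        fun θ hθ => by
          rw [(hG θ hθ).KL_eq.1, ENNReal.toReal_ofReal (hG θ hθ).KL_eq.2]
      set r : ℝ := θc * (1 / (2 * (1 / (8 * K ^ 2)))) with hr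
      have hr0 : 0 < r := by positivity
      obtain ⟨b, hab, hb⟩ := exists_between (lt_min ha.1.1.2 (lt_add_of_pos_right a (div_pos hη hr0)))
      have hbc : b ∈ Set.Ioo 0 θc := ⟨ha.1.1.1.trans hab, hb.trans_le (min_le_left _ _)⟩
      have hbm := hpos b hbc
      refine ⟨b, u b, ν b, hG b hbm, hθK b hbm, ?_, ?_⟩
      · rw [haδ]
        exact hgt b ⟨hab, hbc.2⟩
      · have h1 := entropy_sub_le_of_variational (D := fun θ => (KL (ν θ) μ).toReal) hc hvar hbm ham
        simp only [hKL b hbm, hKL a ham] at h1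
        have h2 : |b - a| ≤ η / r := by
          rw [abs_of_pos (sub_pos.2 hab)]
          linarith [hb.trans_le (min_le_right _ _)]
        have h3 : r * |b - a| ≤ η := by
          rwa [le_div_iff₀ hr0, mul_comm] at h2
        rw [← mul_assoc, ← hr] at h1
        linarith
  · refine continuousOn_Gfun_of_forall_exists hμ hθc0.le hθcK.le fun δ hδ => ?_
    obtain ⟨a, ha, -⟩ := hgreat δ hδ
    exact ⟨a, ha.1.1, ν a, u a, hG a (hpos a ha.1.1), ha.1.2⟩

end
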